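/- arXiv:1912.07858 — 2 statements merged into one kernel-verified Lean document; each statement's English description precedes it below -/
import Mathlib

section
/- For any positive real numbers b and ε, there exists a constant N such that for every d-regular simple graph G with n vertices, where n ≥ N and ln^{1+6b+12ε} n ≤ d ≤ n / ln^{2b+5ε} n, the irregularity strength of G satisfies s(G) ≤ (n/d)·(1 + 8/ln^b n). -/
open Finset

/-- The weighted degree of a vertex `v` under an edge weighting `ω`:
the sum of the weights of the edges incident to `v`. -/
def weightedDeg {V : Type} (G : SimpleGraph V) [Fintype V] [DecidableRel G.Adj]
    (ω : Sym2 V → ℕ) (v : V) : ℕ :=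
  ∑ u ∈ G.neighborFinset v, ω s(v, u)

/-- The irregularity strength of `G`: the least `k` such that some weighting
`ω : E(G) → {1, …, k}` yields pairwise distinct weighted degrees. -/
noncomputable def irregularityStrength {V : Type} (G : SimpleGraph V) [Fintype V]
    [DecidableRel G.Adj] : ℕ :=
  sInf {k : ℕ | ∃ ω : Sym2 V → ℕ,
    (∀ e ∈ G.edgeSet, 1 ≤ ω e ∧ ω e ≤ k) ∧
    ∀ u v : V, u ≠ v → weightedDeg G ω u ≠ weightedDeg G ω v}

/-- Exponential moment bound for the centred number of `u ∈ S` with `f u ∈ T`, where `f` ranges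
over all functions `V → Λ`. -/
theorem sum_exp_centred_le {V Λ : Type*} [Fintype V] [DecidableEq V] [Fintype Λ] [DecidableEq Λ]
    [Nonempty Λ] (S : Finset V) (T : Finset Λ) (t : ℝ) (ht : |t| ≤ 1) :
    ∑ f : V → Λ, Real.exp (t * ((#{u ∈ S | f u ∈ T} : ℝ) - #S * (#T / Fintype.card Λ))) ≤
      (Fintype.card Λ : ℝ) ^ Fintype.card V * Real.exp (t ^ 2 * #S) := by
  set μ : ℝ := #T / Fintype.card Λ with hμ
  have hΛ : (0 : ℝ) < Fintype.card Λ := by exact_mod_cast Fintype.card_pos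
  have hTΛ : (#T : ℝ) ≤ Fintype.card Λ := by exact_mod_cast T.card_le_univ
  have hμ0 : 0 ≤ μ := by positivity
  have hμ1 : μ ≤ 1 := by rw [hμ, div_le_one hΛ]; exact hTΛ
  let z : Λ → ℝ := fun l => (if l ∈ T then 1 else 0) - μ
  have hz : ∀ l, |z l| ≤ 1 := by
    intro l
    simp only [z]
    split_ifs <;> rw [abs_le] <;> constructor <;> linarith
  have hz0 : ∑ l, z l = 0 := by
    simp only [z, Finset.sum_sub_distrib, Finset.sum_const, Finset.card_univ, nsmul_eq_mul, hμ]
    simp only [Finset.sum_ite_mem, Finset.univ_inter, Finset.sum_const, nsmul_eq_mul, mul_one]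
    field_simp
    ring
  let g : V → Λ → ℝ := fun u l => if u ∈ S then Real.exp (t * z l) else 1
  have hfac : ∀ f : V → Λ,
      Real.exp (t * ((#{u ∈ S | f u ∈ T} : ℝ) - #S * μ)) = ∏ u, g u (f u) := by
    intro f
    have : (#{u ∈ S | f u ∈ T} : ℝ) - #S * μ = ∑ u ∈ S, z (f u) := by
      simp only [z, Finset.sum_sub_distrib, Finset.sum_const, nsmul_eq_mul]
      simp
    rw [this, Finset.mul_sum, Real.exp_sum]
    simp only [g]
    rw [Finset.prod_ite_mem, Finset.univ_inter]
  have hone : ∀ u, ∑ l, g u l ≤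
      Fintype.card Λ * (if u ∈ S then Real.exp (t ^ 2) else 1) := by
    intro u
    by_cases hu : u ∈ S
    · simp only [g, hu, if_true]
      have hle : ∀ l, Real.exp (t * z l) ≤ 1 + t * z l + t ^ 2 := by
        intro l
        have h1 : |t * z l| ≤ 1 := by
          rw [abs_mul]; exact mul_le_one₀ ht (abs_nonneg _) (hz l)
        have h2 := Real.abs_exp_sub_one_sub_id_le h1
        have h3 := (abs_le.1 h2).2
        have h4 : (t * z l) ^ 2 ≤ t ^ 2 := by
          rw [mul_pow]
          have : (z l) ^ 2 ≤ 1 := by rw [← sq_abs]; exact pow_le_one₀ (abs_nonneg _) (hz l)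
          nlinarith [sq_nonneg t]
        linarith
      calc ∑ l, Real.exp (t * z l) ≤ ∑ l, (1 + t * z l + t ^ 2) :=
            Finset.sum_le_sum fun l _ => hle l
        _ = Fintype.card Λ * (t ^ 2 + 1) := by
            rw [Finset.sum_add_distrib, Finset.sum_add_distrib, ← Finset.mul_sum, hz0]
            simp
            ring
        _ ≤ _ := by gcongr; exact Real.add_one_le_exp _
    · simp [g, hu]
  calc ∑ f : V → Λ, Real.exp (t * ((#{u ∈ S | f u ∈ T} : ℝ) - #S * μ))
      = ∑ f : V → Λ, ∏ u, g u (f u) := Finset.sum_congr rfl fun f _ => hfac f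
    _ = ∏ u, ∑ l, g u l := by
        rw [Finset.prod_univ_sum]; simp
    _ ≤ ∏ u, (Fintype.card Λ * (if u ∈ S then Real.exp (t ^ 2) else 1)) := by
        apply Finset.prod_le_prod
        · intro u _
          apply Finset.sum_nonneg
          intro l _
          simp only [g]; split_ifs <;> positivity
        · intro u _; exact hone u
    _ = _ := by
        rw [Finset.prod_mul_distrib, Finset.prod_const, Finset.prod_ite_mem, Finset.univ_inter,
          Finset.prod_const, Finset.card_univ, ← Real.exp_nat_mul, mul_comm (#S : ℝ)]

/-- Chernoff bound, in counting form, for one of the two tails (`c = 1` or `c = -1`). -/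
theorem card_tail_le {V Λ : Type*} [Fintype V] [DecidableEq V] [Fintype Λ] [DecidableEq Λ]
    [Nonempty Λ] (S : Finset V) (T : Finset Λ) (δ c : ℝ) (hδ : 0 ≤ δ) (hδ1 : δ ≤ 1)
    (hc : c ^ 2 = 1) :
    (#{f : V → Λ | δ * #S < c * ((#{u ∈ S | f u ∈ T} : ℝ) - #S * (#T / Fintype.card Λ))} : ℝ) ≤
      (Fintype.card Λ : ℝ) ^ Fintype.card V * Real.exp (-(δ ^ 2 * #S / 4)) := by
  have hca : |c| = 1 := by rw [← sq_eq_sq₀ (abs_nonneg c) zero_le_one, sq_abs, hc, one_pow]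
  have ht : |c * δ / 2| ≤ 1 := by
    rw [abs_div, abs_mul, hca, abs_of_nonneg hδ, abs_two]; linarith
  have h := sum_exp_centred_le S T (c * δ / 2) ht
  have hlow : (#{f : V → Λ | δ * #S < c * ((#{u ∈ S | f u ∈ T} : ℝ) -
      #S * (#T / Fintype.card Λ))} : ℝ) * Real.exp (δ ^ 2 * #S / 2) ≤
      ∑ f : V → Λ, Real.exp (c * δ / 2 *
        ((#{u ∈ S | f u ∈ T} : ℝ) - #S * (#T / Fintype.card Λ))) := by
    rw [← nsmul_eq_mul, ← Finset.sum_const]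
    refine (Finset.sum_le_sum fun f hf => ?_).trans
      (Finset.sum_le_sum_of_subset_of_nonneg (Finset.filter_subset _ _)
        fun _ _ _ => (Real.exp_pos _).le)
    rw [Finset.mem_filter] at hf
    rw [Real.exp_le_exp]
    nlinarith [mul_le_mul_of_nonneg_left hf.2.le hδ]
  have h2 := hlow.trans h
  have h3 : (c * δ / 2) ^ 2 * (#S : ℝ) = δ ^ 2 * #S / 4 := by
    rw [div_pow, mul_pow, hc]; ring
  rw [h3] at h2
  have h4 : Real.exp (-(δ ^ 2 * #S / 4)) * Real.exp (δ ^ 2 * #S / 2) =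
      Real.exp (δ ^ 2 * #S / 4) := by
    rw [← Real.exp_add]; congr 1; ring
  rw [← h4, ← mul_assoc] at h2
  exact le_of_mul_le_mul_right h2 (Real.exp_pos _)

/-- Simultaneous concentration: some `f : V → Λ` meets every set `T i` on every `S i` roughly as
often as expected, provided the sum of the failure probabilities is below one. -/
theorem exists_forall_abs_card_sub_le {V Λ ι : Type*} [Fintype V] [DecidableEq V] [Fintype Λ]
    [DecidableEq Λ] [Nonempty Λ] [Fintype ι] (S : ι → Finset V) (T : ι → Finset Λ) (δ : ι → ℝ)
    (hδ : ∀ i, 0 ≤ δ i) (hδ1 : ∀ i, δ i ≤ 1)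
    (hsum : ∑ i, 2 * Real.exp (-(δ i ^ 2 * #(S i) / 4)) < 1) :
    ∃ f : V → Λ, ∀ i,
      |(#{u ∈ S i | f u ∈ T i} : ℝ) - #(S i) * (#(T i) / Fintype.card Λ)| ≤ δ i * #(S i) := by
  by_contra hcon
  push Not at hcon
  let bad : ι → ℝ → Finset (V → Λ) := fun i c =>
    {f : V → Λ | δ i * #(S i) <
      c * ((#{u ∈ S i | f u ∈ T i} : ℝ) - #(S i) * (#(T i) / Fintype.card Λ))}
  have hcover : (Finset.univ : Finset (V → Λ)) ⊆
      Finset.univ.biUnion fun i => bad i 1 ∪ bad i (-1) := by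
    intro f _
    obtain ⟨i, hi⟩ := hcon f
    rw [Finset.mem_biUnion]
    refine ⟨i, Finset.mem_univ _, ?_⟩
    simp only [bad, Finset.mem_union, Finset.mem_filter, Finset.mem_univ, true_and]
    rcases lt_abs.1 hi with h | h
    · left; linarith
    · right; linarith
  have hpos : (0 : ℝ) < (Fintype.card Λ : ℝ) ^ Fintype.card V := by
    have : (0 : ℝ) < Fintype.card Λ := by exact_mod_cast Fintype.card_pos
    positivity
  have hcard : ((Fintype.card Λ : ℝ) ^ Fintype.card V) ≤
      ∑ i, ((#(bad i 1) : ℝ) + #(bad i (-1))) := by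
    have h1 := (Finset.card_le_card hcover).trans Finset.card_biUnion_le
    have h2 := h1.trans (Finset.sum_le_sum fun i _ => Finset.card_union_le (bad i 1) (bad i (-1)))
    rw [Finset.card_univ, Fintype.card_fun] at h2
    exact_mod_cast h2
  have hle : ∑ i, ((#(bad i 1) : ℝ) + #(bad i (-1))) ≤
      ∑ i, (Fintype.card Λ : ℝ) ^ Fintype.card V *
        (2 * Real.exp (-(δ i ^ 2 * #(S i) / 4))) := by
    apply Finset.sum_le_sum
    intro i _
    have h1 := card_tail_le (S i) (T i) (δ i) 1 (hδ i) (hδ1 i) (by norm_num)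
    have h2 := card_tail_le (S i) (T i) (δ i) (-1) (hδ i) (hδ1 i) (by norm_num)
    simp only [bad]
    linarith
  rw [← Finset.mul_sum] at hle
  nlinarith

/-- A total of at most `K * #S` can be split over `S` into parts of size at most `K`. -/
theorem exists_le_sum_eq {α : Type*} [DecidableEq α] (K : ℕ) (S : Finset α) :
    ∀ T : ℕ, T ≤ K * #S → ∃ f : α → ℕ, (∀ a, f a ≤ K) ∧ ∑ a ∈ S, f a = T := by
  induction S using Finset.induction_on with
  | empty => intro T hT; exact ⟨fun _ => 0, fun _ => Nat.zero_le _, by simp_all⟩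
  | insert a S ha ih =>
    intro T hT
    rw [Finset.card_insert_of_notMem ha, mul_add, mul_one] at hT
    obtain ⟨f, hf, hs⟩ := ih (T - min T K) (by omega)
    refine ⟨Function.update f a (min T K), fun b => ?_, ?_⟩
    · by_cases hb : b = a
      · subst hb; simp
      · simpa [hb] using hf b
    · rw [Finset.sum_insert ha, Function.update_self,
        Finset.sum_congr rfl fun b hb =>
          Function.update_of_ne (ne_of_mem_of_not_mem hb ha) (min T K) f, hs]
      omega

/-- If every fibre of `cl` on `A` fits into its set `F i` of admissible values and these sets are
pairwise disjoint, then the elements of `A` can be given distinct admissible values. -/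
theorem exists_injOn_mem_of_fiber_card_le {α ι β : Type*} [DecidableEq ι] [DecidableEq α]
    (A : Finset α) (cl : α → ι) (F : ι → Finset β)
    (hF : ∀ i j, i ≠ j → Disjoint (F i) (F j))
    (hcard : ∀ i, #{a ∈ A | cl a = i} ≤ #(F i)) [Nonempty β] :
    ∃ t : α → β, (∀ a ∈ A, t a ∈ F (cl a)) ∧ Set.InjOn t A := by
  classical
  have h : ∀ i, ∃ t : α → β, (∀ a ∈ A, cl a = i → t a ∈ F i) ∧
      Set.InjOn t ({a ∈ A | cl a = i} : Finset α) := by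
    intro i
    obtain ⟨t, ht, hinj⟩ := Set.Finite.exists_injOn_of_encard_le
      (Finset.finite_toSet {a ∈ A | cl a = i}) (t := (F i : Set β))
      (by rw [Set.encard_coe_eq_coe_finsetCard, Set.encard_coe_eq_coe_finsetCard]
          exact_mod_cast hcard i)
    refine ⟨t, fun a ha hi => ?_, hinj⟩
    simpa using ht (show a ∈ (({a ∈ A | cl a = i} : Finset α) : Set α) by simp [ha, hi])
  choose t ht hinj using h
  refine ⟨fun a => t (cl a) a, fun a ha => ht _ a ha rfl, ?_⟩
  intro a ha b hb hab
  have hta := ht _ a ha rfl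
  have htb := ht _ b hb rfl
  by_cases hcl : cl a = cl b
  · refine hinj (cl a) (by simpa using ha) (by simpa [hcl] using hb) ?_
    simpa [hcl] using hab
  · simp only at hab
    rw [hab] at hta
    exact absurd htb (Finset.disjoint_left.1 (hF _ _ hcl) hta)

/-- A set of naturals that is a union of residue classes modulo `a`, and so has `c` elements in
every interval of length `a`, has at least `q * c` elements in every interval of length `q * a`. -/
theorem mul_count_le_card_filter_Ico (p : ℕ → Prop) [DecidablePred p] (a : ℕ)
    (hp : Function.Periodic p a) (s q l : ℕ) (hl : q * a ≤ l) :
    q * a.count p ≤ #{x ∈ Finset.Ico s (s + l) | p x} := by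
  have h : ∀ q : ℕ, #{x ∈ Finset.Ico s (s + q * a) | p x} = q * a.count p := by
    intro q
    induction q with
    | zero => simp
    | succ q ih =>
      have h1 : Finset.Ico s (s + (q + 1) * a) =
          Finset.Ico s (s + q * a) ∪ Finset.Ico (s + q * a) (s + q * a + a) := by
        rw [Finset.Ico_union_Ico_eq_Ico (by omega) (by omega)]
        congr 1; ring
      rw [h1, Finset.filter_union, Finset.card_union_of_disjoint, ih,
        Nat.filter_Ico_card_eq_of_periodic _ _ _ hp]
      · ring
      · exact Finset.disjoint_filter_filter (Finset.Ico_disjoint_Ico_consecutive _ _ _)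
  rw [← h q]
  apply Finset.card_le_card
  apply Finset.filter_subset_filter
  apply Finset.Ico_subset_Ico_right
  omega

/-- The set of `x` whose block number `x / K` has a residue modulo `M` satisfying `p`. -/
theorem count_block {K M : ℕ} (hK : 0 < K) (p : ℕ → Prop) [DecidablePred p] :
    (K * M).count (fun x => p (x / K % M)) = K * M.count p := by
  have h : ∀ m ≤ M, (K * m).count (fun x => p (x / K % M)) = K * m.count p := by
    intro m
    induction m with
    | zero => simp
    | succ m ih =>
      intro hm
      rw [mul_add, mul_one, Nat.count_add, ih (by omega), Nat.count_succ, mul_add]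
      congr 1
      rw [Nat.count_eq_card_filter_range]
      have hb : ∀ x ∈ Finset.range K, (K * m + x) / K % M = m := by
        intro x hx
        rw [Finset.mem_range] at hx
        rw [Nat.mul_add_div hK, Nat.div_eq_of_lt hx, add_zero, Nat.mod_eq_of_lt (by omega)]
      rw [Finset.filter_congr (q := fun _ => p m) fun x hx => by rw [hb x hx]]
      by_cases hpm : p m <;> simp [hpm]
  exact h M le_rfl

theorem mul_count_block_le_card_filter_Ico {K M : ℕ} (hK : 0 < K) (p : ℕ → Prop)
    [DecidablePred p] (s l : ℕ) :
    l / (K * M) * (K * M.count p) ≤ #{x ∈ Finset.Ico s (s + l) | p (x / K % M)} := by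
  rw [← count_block hK p]
  apply mul_count_le_card_filter_Ico
  · intro x
    simp only [eq_iff_iff]
    rw [Nat.add_mul_div_left _ _ hK, Nat.add_mod_right]
  · exact Nat.div_mul_le_self _ _

/-- Weights in `{0, …, K - 1}` on the edges inside `C` can be chosen so that every vertex of `C`
shares its residue modulo `K` with few of the vertices `W`-related to it. -/
theorem exists_balanced_residues {V : Type*} [Fintype V] [DecidableEq V] (G : SimpleGraph V)
    [DecidableRel G.Adj] (C : Finset V) (K B : ℕ) (hK : 0 < K) (r : V → ℕ) (W : V → V → Prop)
    [DecidableRel W] (hW : ∀ u v, W u v → W v u)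
    (hC : ∀ c ∈ C, ∃ c' ∈ C, G.Adj c c')
    (hB : ∀ c ∈ C, #{c' ∈ C | W c c'} ≤ B) :
    ∃ x : Sym2 V → ℕ, (∀ e, x e < K) ∧ ∀ c ∈ C,
      K * #{c' ∈ C | c' ≠ c ∧ W c c' ∧
        (r c + ∑ u ∈ G.neighborFinset c ∩ C, x s(c, u)) ≡
        (r c' + ∑ u ∈ G.neighborFinset c' ∩ C, x s(c', u)) [MOD K]} ≤ 4 * B + K := by
  classical
  have : NeZero K := ⟨hK.ne'⟩
  let val : (Sym2 V → ZMod K) → V → ZMod K := fun x c =>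
    r c + ∑ u ∈ G.neighborFinset c ∩ C, x s(c, u)
  let Q : Finset (V × V) := {p ∈ C ×ˢ C | p.1 ≠ p.2 ∧ W p.1 p.2}
  let Φ : (Sym2 V → ZMod K) → ℕ := fun x => #{p ∈ Q | val x p.1 = val x p.2}
  obtain ⟨x, -, hx⟩ := Finset.exists_min_image (Finset.univ : Finset (Sym2 V → ZMod K)) Φ
    Finset.univ_nonempty
  refine ⟨fun e => (x e).val, fun e => ZMod.val_lt _, fun c hc => ?_⟩
  have hset : ({c' ∈ C | c' ≠ c ∧ W c c' ∧
      (r c + ∑ u ∈ G.neighborFinset c ∩ C, (x s(c, u)).val) ≡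
      (r c' + ∑ u ∈ G.neighborFinset c' ∩ C, (x s(c', u)).val) [MOD K]} : Finset V) =
      {c' ∈ C | c' ≠ c ∧ W c c' ∧ val x c = val x c'} := by
    apply Finset.filter_congr
    intro c' _
    rw [← ZMod.natCast_eq_natCast_iff]
    simp [val]
  rw [hset]
  obtain ⟨c₁, hc₁, hadj⟩ := hC c hc
  have hne : c ≠ c₁ := hadj.ne
  -- shift the weight of the edge `c c₁` by `t`
  let X : ZMod K → Sym2 V → ZMod K := fun t => Function.update x s(c, c₁) (x s(c, c₁) + t)
  let I : V → Prop := fun v => v = c ∨ v = c₁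
  have hval : ∀ t, ∀ v ∈ C, val (X t) v = val x v + if I v then t else 0 := by
    intro t v hv
    have key : ∀ w, w ∈ G.neighborFinset v ∩ C → s(v, w) = s(c, c₁) → ∀ u ∈ G.neighborFinset v ∩ C,
        u ≠ w → X t s(v, u) = x s(v, u) := by
      intro w _ hw u _ huw
      refine Function.update_of_ne ?_ _ _
      rw [← hw]
      intro h
      exact huw (Sym2.congr_right.1 h)
    have hcase : ∀ w ∈ G.neighborFinset v ∩ C, s(v, w) = s(c, c₁) →
        val (X t) v = val x v + t := by
      intro w hw hvw
      simp only [val]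
      rw [← Finset.add_sum_erase _ _ hw, ← Finset.add_sum_erase _ (fun u => x s(v, u)) hw,
        Finset.sum_congr rfl fun u hu => key w hw hvw u (Finset.mem_of_mem_erase hu)
          (Finset.ne_of_mem_erase hu), hvw]
      simp only [X, Function.update_self]
      ring
    by_cases hI : I v
    · rw [if_pos hI]
      rcases hI with rfl | rfl
      · exact hcase c₁ (by simp [hadj, hc₁]) rfl
      · exact hcase c (by simp [hadj.symm, hc]) Sym2.eq_swap
    · rw [if_neg hI, add_zero]
      simp only [val]
      congr 1
      apply Finset.sum_congr rfl
      intro u _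
      refine Function.update_of_ne ?_ _ _
      intro h
      rw [Sym2.eq_iff] at h
      apply hI
      rcases h with h | h
      · exact Or.inl h.1
      · exact Or.inr h.1
  let Q₁ : Finset (V × V) := {p ∈ Q | ¬ (I p.1 ↔ I p.2)}
  have hQC : ∀ p ∈ Q, p.1 ∈ C ∧ p.2 ∈ C := by
    intro p hp
    simp only [Q, Finset.mem_filter, Finset.mem_product] at hp
    exact hp.1
  have hpair : ∀ p ∈ Q, (∑ t : ZMod K, if val (X t) p.1 = val (X t) p.2 then 1 else 0) =
      if (I p.1 ↔ I p.2) then K * (if val x p.1 = val x p.2 then 1 else 0) else 1 := by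
    intro p hp
    obtain ⟨h1, h2⟩ := hQC p hp
    have : ∀ t, (val (X t) p.1 = val (X t) p.2 ↔
        val x p.1 + (if I p.1 then t else 0) = val x p.2 + (if I p.2 then t else 0)) := by
      intro t; rw [hval t _ h1, hval t _ h2]
    simp only [this]
    by_cases i1 : I p.1 <;> by_cases i2 : I p.2
    · simp [i1, i2, ZMod.card]
    · simp only [i1, i2, if_true, if_false, add_zero, iff_false, not_true]
      rw [Finset.sum_congr rfl (g := fun t => if t = val x p.2 - val x p.1 then 1 else 0)]
      · simp
      · intro t _
        congr 1
        rw [eq_iff_iff]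
        constructor
        · intro h; rw [← h]; ring
        · intro h; rw [h]; ring
    · simp only [i1, i2, if_true, if_false, add_zero, iff_true]
      rw [Finset.sum_congr rfl (g := fun t => if t = val x p.1 - val x p.2 then 1 else 0)]
      · simp
      · intro t _
        congr 1
        rw [eq_iff_iff]
        constructor
        · intro h; rw [h]; ring
        · intro h; rw [h]; ring
    · simp [i1, i2, ZMod.card]
  have hmin : K * Φ x ≤ ∑ t : ZMod K, Φ (X t) := by
    calc K * Φ x = ∑ _t : ZMod K, Φ x := by simp [ZMod.card]
      _ ≤ _ := Finset.sum_le_sum fun t _ => hx (X t) (Finset.mem_univ _)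
  have hΦ : ∀ y, Φ y = ∑ p ∈ Q, if val y p.1 = val y p.2 then 1 else 0 := by
    intro y; simp only [Φ, Finset.card_filter]
  have hkey : K * #{p ∈ Q₁ | val x p.1 = val x p.2} ≤ #Q₁ := by
    rw [hΦ x] at hmin
    simp only [hΦ] at hmin
    rw [Finset.sum_comm, Finset.sum_congr rfl hpair, Finset.mul_sum,
      ← Finset.sum_filter_add_sum_filter_not Q (fun p => (I p.1 ↔ I p.2)),
      ← Finset.sum_filter_add_sum_filter_not Q (fun p => (I p.1 ↔ I p.2))
        (fun p => if (I p.1 ↔ I p.2) then _ else _)] at hmin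
    have e1 : ∑ p ∈ Q with (I p.1 ↔ I p.2), (if (I p.1 ↔ I p.2) then
        K * (if val x p.1 = val x p.2 then 1 else 0) else 1) =
        ∑ p ∈ Q with (I p.1 ↔ I p.2), K * (if val x p.1 = val x p.2 then 1 else 0) :=
      Finset.sum_congr rfl fun p hp => if_pos (Finset.mem_filter.1 hp).2
    have e2 : ∑ p ∈ Q with ¬ (I p.1 ↔ I p.2), (if (I p.1 ↔ I p.2) then
        K * (if val x p.1 = val x p.2 then 1 else 0) else 1) = #Q₁ := by
      rw [Finset.sum_congr rfl fun p hp => if_neg (Finset.mem_filter.1 hp).2]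
      simp [Q₁]
    rw [e1, e2] at hmin
    have := Nat.le_of_add_le_add_left hmin
    rw [← Finset.mul_sum] at this
    rw [Finset.card_filter]
    exact this
  have hQ₁ : #Q₁ ≤ 4 * B := by
    have hsub : Q₁ ⊆ (({c} ×ˢ ({c' ∈ C | W c c'}) ∪ {c₁} ×ˢ ({c' ∈ C | W c₁ c'})) ∪
        (({c' ∈ C | W c c'}) ×ˢ {c} ∪ ({c' ∈ C | W c₁ c'}) ×ˢ {c₁})) := by
      rintro ⟨u, v⟩ hp
      simp only [Q₁, Q, I, Finset.mem_filter, Finset.mem_product] at hp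
      simp only [Finset.mem_union, Finset.mem_product, Finset.mem_singleton, Finset.mem_filter]
      obtain ⟨⟨⟨hu, hv⟩, _, hw⟩, hI⟩ := hp
      have hw' := hW _ _ hw
      by_cases h1 : u = c
      · subst h1; tauto
      · by_cases h2 : u = c₁
        · subst h2; tauto
        · have h3 : v = c ∨ v = c₁ := by tauto
          rcases h3 with rfl | rfl <;> tauto
    refine (Finset.card_le_card hsub).trans ((Finset.card_union_le _ _).trans ?_)
    have b1 := hB c hc
    have b2 := hB c₁ hc₁
    refine (Nat.add_le_add (Finset.card_union_le _ _) (Finset.card_union_le _ _)).trans ?_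
    simp only [Finset.card_product, Finset.card_singleton, one_mul, mul_one]
    omega
  have hconf : #{c' ∈ C | c' ≠ c ∧ W c c' ∧ val x c = val x c'} ≤
      #{p ∈ Q₁ | val x p.1 = val x p.2} + 1 := by
    have hsub : ({c' ∈ C | c' ≠ c ∧ W c c' ∧ val x c = val x c'} : Finset V) ⊆
        insert c₁ (Finset.image Prod.snd {p ∈ Q₁ | val x p.1 = val x p.2}) := by
      intro v hv
      simp only [Finset.mem_filter] at hv
      obtain ⟨hv, hvc, hw, he⟩ := hv
      by_cases h : v = c₁
      · simp [h]
      · refine Finset.mem_insert_of_mem (Finset.mem_image.2 ⟨(c, v), ?_, rfl⟩)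
        simp only [Q₁, Q, I, Finset.mem_filter, Finset.mem_product]
        refine ⟨⟨⟨⟨hc, hv⟩, hvc.symm, hw⟩, ?_⟩, he⟩
        simp [hvc, h]
    exact (Finset.card_le_card hsub).trans ((Finset.card_insert_le _ _).trans
      (Nat.add_le_add_right Finset.card_image_le 1))
  calc K * #{c' ∈ C | c' ≠ c ∧ W c c' ∧ val x c = val x c'}
      ≤ K * (#{p ∈ Q₁ | val x p.1 = val x p.2} + 1) := Nat.mul_le_mul_left _ hconf
    _ = K * #{p ∈ Q₁ | val x p.1 = val x p.2} + K := by ring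
    _ ≤ 4 * B + K := by omega

/-- With bits `τ` given on `N`, flipping some of them can change their total by any `j` from minus
the number of ones to the number of zeros. -/
theorem exists_bit_flips {α : Type*} [DecidableEq α] (N : Finset α) (τ : α → ℤ)
    (hτ : ∀ a, τ a = 0 ∨ τ a = 1) (j : ℤ) (hj : -(#{a ∈ N | τ a = 1} : ℤ) ≤ j)
    (hj' : j ≤ #{a ∈ N | τ a = 0}) :
    ∃ z : α → ℤ, (∀ a, |z a| ≤ 1) ∧ (∀ a, z a ≠ 0 → a ∈ N) ∧
      (∀ a, τ a + z a = 0 ∨ τ a + z a = 1) ∧ ∑ a ∈ N, z a = j := by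
  rcases le_total 0 j with h | h
  · obtain ⟨S, hS, hcard⟩ := Finset.exists_subset_card_eq
      (s := {a ∈ N | τ a = 0}) (n := j.toNat) (by omega)
    refine ⟨fun a => if a ∈ S then 1 else 0, fun a => ?_, fun a ha => ?_, fun a => ?_, ?_⟩
    · dsimp only; split_ifs <;> simp
    · have : a ∈ S := by by_contra h; simp [h] at ha
      exact (Finset.mem_filter.1 (hS this)).1
    · dsimp only
      split_ifs with ha
      · right; rw [(Finset.mem_filter.1 (hS ha)).2]; rfl
      · simpa using hτ a
    · rw [Finset.sum_ite_mem, Finset.inter_eq_right.2 (hS.trans (Finset.filter_subset _ _))]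
      simp [hcard, h]
  · obtain ⟨S, hS, hcard⟩ := Finset.exists_subset_card_eq
      (s := {a ∈ N | τ a = 1}) (n := (-j).toNat) (by omega)
    refine ⟨fun a => if a ∈ S then -1 else 0, fun a => ?_, fun a ha => ?_, fun a => ?_, ?_⟩
    · dsimp only; split_ifs <;> simp
    · have : a ∈ S := by by_contra h; simp [h] at ha
      exact (Finset.mem_filter.1 (hS this)).1
    · dsimp only
      split_ifs with ha
      · left; rw [(Finset.mem_filter.1 (hS ha)).2]; rfl
      · simpa using hτ a
    · rw [Finset.sum_ite_mem, Finset.inter_eq_right.2 (hS.trans (Finset.filter_subset _ _))]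
      simp [hcard, h]

/-- Among `g * M` consecutive multiples of `K` added to `v`, one leads to a number whose block
has residue `ρ` and which avoids a given set with fewer than `g` elements. -/
theorem exists_shift_mem_block {K M g : ℕ} (hK : 0 < K) (ρ : ℕ) (hρ : ρ < M) (v l : ℤ)
    (O : Finset ℤ) (hO : #O < g) :
    ∃ j : ℤ, l ≤ j ∧ j < l + g * M ∧ (v + K * j) / K % M = ρ ∧ v + K * j ∉ O := by
  have hM : (0 : ℤ) < M := by exact_mod_cast (Nat.zero_le ρ).trans_lt hρ
  have hK' : (K : ℤ) ≠ 0 := by exact_mod_cast hK.ne'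
  let J : ℕ → ℤ := fun i => l + (ρ - v / K - l) % M + i * M
  have hinj : Function.Injective fun i => v + K * J i := by
    intro i i' h
    have h1 : J i = J i' := mul_left_cancel₀ hK' (add_left_cancel h)
    have h2 : (i : ℤ) * M = i' * M := add_left_cancel h1
    exact_mod_cast mul_right_cancel₀ hM.ne' h2
  have hex : ∃ i ∈ Finset.range g, v + K * J i ∉ O := by
    by_contra hcon
    push Not at hcon
    have : (Finset.range g).image (fun i => v + K * J i) ⊆ O := by
      intro y hy
      obtain ⟨i, hi, rfl⟩ := Finset.mem_image.1 hy
      exact hcon i hi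
    have h := Finset.card_le_card this
    rw [Finset.card_image_of_injective _ hinj, Finset.card_range] at h
    omega
  obtain ⟨i, hi, hiO⟩ := hex
  have h0 := Int.emod_nonneg (ρ - v / K - l) hM.ne'
  have h1 := Int.emod_lt_of_pos (ρ - v / K - l) hM
  refine ⟨J i, ?_, ?_, ?_, hiO⟩
  · have : (0 : ℤ) ≤ i * M := by positivity
    simp only [J]; linarith
  · have : (i : ℤ) + 1 ≤ g := by exact_mod_cast Finset.mem_range.1 hi
    simp only [J]; nlinarith
  · rw [Int.add_mul_ediv_left _ _ hK']
    have h2 := Int.emod_add_mul_ediv (ρ - v / K - l) M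
    have h3 : v / K + J i = ρ + M * (i - (ρ - v / K - l) / M) := by
      simp only [J]; linear_combination h2
    rw [h3, Int.add_mul_emod_self_left]
    exact Int.emod_eq_of_lt (by positivity) (by exact_mod_cast hρ)

/-- Toggling the values of the vertices in `A` between two options that differ by `K`, one can
make the values on `C` distinct and place them in blocks of residue `ρ`. Here `y a c` records the
change, in units of `K`, of the weight of the edge `a c`. -/
theorem exists_toggles {V : Type*} [Fintype V] [DecidableEq V] (G : SimpleGraph V)
    [DecidableRel G.Adj] (A C : Finset V) {K M g D : ℕ} (hK : 0 < K) (ρ : ℕ) (hρ : ρ < M)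
    (v : V → ℤ) (R : V → V → Prop) [DecidableRel R]
    (hD : ∀ c, #(G.neighborFinset c) ≤ D)
    (hR : ∀ c ∈ C, ∀ c' ∈ C, c ≠ c' → ∀ j j' : ℤ, |j| ≤ D → |j'| ≤ D →
      v c + K * j = v c' + K * j' → R c c')
    (hconf : ∀ c ∈ C, #{c' ∈ C | c' ≠ c ∧ R c c'} < g)
    (hdeg : ∀ c ∈ C, g * M ≤ #(G.neighborFinset c ∩ A) + 1) :
    ∃ y : V → V → ℤ, (∀ a c, |y a c| ≤ 1) ∧
      (∀ a c, y a c ≠ 0 → a ∈ A ∧ c ∈ C ∧ G.Adj c a) ∧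
      (∀ a, ∑ c, y a c = 0 ∨ ∑ c, y a c = 1) ∧
      (∀ c ∈ C, (v c + K * ∑ a, y a c) / K % M = ρ) ∧
      (∀ c ∈ C, ∀ c' ∈ C, c ≠ c' → v c + K * ∑ a, y a c ≠ v c' + K * ∑ a, y a c') := by
  suffices h : ∀ Q ⊆ C, ∃ y : V → V → ℤ, (∀ a c, |y a c| ≤ 1) ∧
      (∀ a c, y a c ≠ 0 → a ∈ A ∧ c ∈ Q ∧ G.Adj c a) ∧
      (∀ a, ∑ c, y a c = 0 ∨ ∑ c, y a c = 1) ∧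
      (∀ c ∈ Q, (v c + K * ∑ a, y a c) / K % M = ρ) ∧
      (∀ c ∈ Q, ∀ c' ∈ Q, c ≠ c' → v c + K * ∑ a, y a c ≠ v c' + K * ∑ a, y a c') from
    h C subset_rfl
  intro Q
  induction Q using Finset.induction_on with
  | empty => exact fun _ => ⟨fun _ _ => 0, by simp⟩
  | insert c Q hcQ ih =>
    intro hQ
    obtain ⟨y, hy1, hy2, hy3, hy4, hy5⟩ := ih ((Finset.subset_insert c Q).trans hQ)
    have hcC : c ∈ C := hQ (Finset.mem_insert_self c Q)
    have hQC : ∀ c' ∈ Q, c' ∈ C := fun c' h => hQ (Finset.mem_insert_of_mem h)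
    have hyc : ∀ a, y a c = 0 := fun a => by
      by_contra h; exact hcQ (hy2 a c h).2.1
    set N := G.neighborFinset c ∩ A with hN
    let τ : V → ℤ := fun a => ∑ c', y a c'
    have hNsplit : #{a ∈ N | τ a = 1} + #{a ∈ N | τ a = 0} = #N := by
      rw [← Finset.card_filter_add_card_filter_not (s := N) (fun a => τ a = 1)]
      congr 2
      apply Finset.filter_congr
      intro a _
      rcases hy3 a with h | h <;> simp [τ, h]
    have hND : #N ≤ D := (Finset.card_le_card Finset.inter_subset_left).trans (hD c)
    let O : Finset ℤ := ({c' ∈ C | c' ≠ c ∧ R c c'}).image fun c' => v c' + K * ∑ a, y a c'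
    obtain ⟨j, hj1, hj2, hj3, hj4⟩ := exists_shift_mem_block (M := M) hK ρ hρ (v c)
      (-(#{a ∈ N | τ a = 1} : ℤ)) O (Finset.card_image_le.trans_lt (hconf c hcC))
    have hgM : ((g * M : ℕ) : ℤ) ≤ #N + 1 := by exact_mod_cast hdeg c hcC
    push_cast at hgM
    have hj2' : j ≤ #{a ∈ N | τ a = 0} := by omega
    obtain ⟨z, hz1, hz2, hz3, hz4⟩ := exists_bit_flips N τ hy3 j hj1 hj2'
    let y' : V → V → ℤ := fun a c' => if c' = c then z a else y a c'
    have hzsum : ∑ a, z a = j := by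
      rw [← hz4]
      symm
      apply Finset.sum_subset (Finset.subset_univ _)
      intro a _ ha
      by_contra h
      exact ha (hz2 a h)
    have hcolc : ∑ a, y' a c = j := by simp [y', hzsum]
    have hcol : ∀ c' ∈ Q, ∑ a, y' a c' = ∑ a, y a c' := by
      intro c' hc'
      have : c' ≠ c := ne_of_mem_of_not_mem hc' hcQ
      simp [y', this]
    have hcolD : ∀ c' ∈ Q, |∑ a, y a c'| ≤ (D : ℤ) := by
      intro c' _
      have h1 : ∑ a, y a c' = ∑ a ∈ G.neighborFinset c', y a c' := by
        symm
        apply Finset.sum_subset (Finset.subset_univ _)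
        intro a _ ha
        by_contra h
        exact ha (by simpa using (hy2 a c' h).2.2)
      rw [h1]
      refine (Finset.abs_sum_le_sum_abs _ _).trans
        ((Finset.sum_le_sum fun a _ => hy1 a c').trans ?_)
      simpa using hD c'
    have hrow : ∀ a, ∑ c', y' a c' = τ a + z a := by
      intro a
      have h1 : ∀ c', y' a c' = y a c' + if c' = c then z a else 0 := by
        intro c'
        by_cases h : c' = c
        · simp [y', h, hyc]
        · simp [y', h]
      simp [h1, Finset.sum_add_distrib, τ]
    have hnew : ∀ c' ∈ Q, v c + K * ∑ a, y' a c ≠ v c' + K * ∑ a, y' a c' := by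
      intro c' hc' heq
      rw [hcolc, hcol c' hc'] at heq
      have hne : c ≠ c' := (ne_of_mem_of_not_mem hc' hcQ).symm
      have hRc := hR c hcC c' (hQC c' hc') hne j _ (by rw [abs_le]; omega) (hcolD c' hc') heq
      refine hj4 (Finset.mem_image.2 ⟨c', ?_, heq.symm⟩)
      simp [hQC c' hc', hne.symm, hRc]
    refine ⟨y', fun a c' => ?_, fun a c' h => ?_, fun a => ?_, fun c' hc' => ?_, ?_⟩
    · simp only [y']; split_ifs
      · exact hz1 a
      · exact hy1 a c'
    · by_cases hc' : c' = c
      · subst hc'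
        have := hz2 a (by simpa [y'] using h)
        rw [hN, Finset.mem_inter, SimpleGraph.mem_neighborFinset] at this
        exact ⟨this.2, Finset.mem_insert_self _ _, this.1⟩
      · have := hy2 a c' (by simpa [y', hc'] using h)
        exact ⟨this.1, Finset.mem_insert_of_mem this.2.1, this.2.2⟩
    · rw [hrow]; exact hz3 a
    · rcases Finset.mem_insert.1 hc' with rfl | hc'
      · rw [hcolc]; exact hj3
      · rw [hcol c' hc']; exact hy4 c' hc'
    · intro c₁ h₁ c₂ h₂ hne
      rw [Finset.mem_insert] at h₁ h₂
      by_cases e₁ : c₁ = c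
      · subst e₁
        exact hnew c₂ (h₂.resolve_left hne.symm)
      · by_cases e₂ : c₂ = c
        · subst e₂
          exact (hnew c₁ (h₁.resolve_left hne)).symm
        · have hQ₁ := h₁.resolve_left e₁
          have hQ₂ := h₂.resolve_left e₂
          rw [hcol c₁ hQ₁, hcol c₂ hQ₂]
          exact hy5 c₁ hQ₁ c₂ hQ₂ hne

/-- Admissible values for the vertices outside `C`: any class `i` of vertices owns the interval of
length `l` starting at `s + i * h / m`, and needs room there among the blocks satisfying `p`. -/
theorem exists_targets {V : Type*} [DecidableEq V] (A : Finset V) (X : V → ℕ)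
    (s h m K M : ℕ) (hK : 0 < K) (p : ℕ → Prop) [DecidablePred p]
    (hcap : ∀ i, #{v ∈ A | X v = i} ≤ h / m / (K * M) * (K * M.count p)) :
    ∃ t : V → ℕ, (∀ v ∈ A, s + X v * h / m ≤ t v ∧ t v < s + X v * h / m + h / m ∧
      p (t v / K % M)) ∧ Set.InjOn t A := by
  let F : ℕ → Finset ℕ := fun i =>
    {x ∈ Finset.Ico (s + i * h / m) (s + i * h / m + h / m) | p (x / K % M)}
  have hlt : ∀ i j, i < j → Disjoint (F i) (F j) := by
    intro i j hij
    rw [Finset.disjoint_left]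
    intro x hx hx'
    simp only [F, Finset.mem_filter, Finset.mem_Ico] at hx hx'
    have h1 : i * h / m + h / m ≤ (i * h + h) / m := Nat.div_add_div_le_add_div
    have h2 : (i * h + h) / m ≤ j * h / m := by
      apply Nat.div_le_div_right
      calc i * h + h = (i + 1) * h := by ring
        _ ≤ j * h := Nat.mul_le_mul_right _ hij
    omega
  obtain ⟨t, ht, hinj⟩ := exists_injOn_mem_of_fiber_card_le A X F
    (fun i j hij => by
      rcases lt_or_gt_of_ne hij with h | h
      · exact hlt i j h
      · exact (hlt j i h).symm)
    (fun i => (hcap i).trans (mul_count_block_le_card_filter_Ico hK p _ _))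
  refine ⟨t, fun v hv => ?_, hinj⟩
  have := ht v hv
  simp only [F, Finset.mem_filter, Finset.mem_Ico] at this
  exact ⟨this.1.1, this.1.2, this.2⟩

set_option maxHeartbeats 1000000 in
/-- If the classes `X` and the sets `A` and `C` behave like random ones, then there is an
irregular weighting with weights at most `1 + H + 3 * K`. -/
theorem exists_irregular_weighting {V : Type} [Fintype V] [DecidableEq V] (G : SimpleGraph V)
    [DecidableRel G.Adj] {d m P K M H g w B : ℕ} (hreg : G.IsRegularOfDegree d)
    (X : V → ℕ) (A C : Finset V) (hAC : Disjoint A C)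
    (hd : 0 < d) (hm : 0 < m) (hK : 0 < K) (hM : 3 ≤ M)
    (hup : ∀ v, m * #{u ∈ G.neighborFinset v | m ≤ X v + X u} ≤ d * (X v + 1))
    (hlo : ∀ v, d * X v ≤ m * #{u ∈ G.neighborFinset v | m ≤ X v + X u} + d)
    (hCup : ∀ v, m * #(G.neighborFinset v ∩ C) ≤ d * (P + 1))
    (hClo : ∀ v, d * P ≤ m * #(G.neighborFinset v ∩ C) + d)
    (hA : ∀ v, g * M ≤ #(G.neighborFinset v ∩ A) + 1)
    (hcap₀ : ∀ i, #{v | X v = i} ≤ H * d / m / (K * M) * (K * (M - 3)))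
    (hcap₁ : ∀ i, #{v ∈ A | X v = i} ≤ H * d / m / (K * M) * K)
    (hroom : 3 * (H * d) + 3 * m + 3 * (K * d) ≤ K * d * P)
    (hw : 2 * H + 4 * (K * m) < H * (w + 1))
    (hB : ∀ c ∈ C, #{c' ∈ C | X c ≤ X c' + w ∧ X c' ≤ X c + w} ≤ B)
    (hBg : 4 * B + K < g * K) :
    ∃ ω : Sym2 V → ℕ, (∀ e ∈ G.edgeSet, 1 ≤ ω e ∧ ω e ≤ 1 + H + 3 * K) ∧
      ∀ u v : V, u ≠ v → weightedDeg G ω u ≠ weightedDeg G ω v := by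
  classical
  have hdeg : ∀ v, #(G.neighborFinset v) = d := fun v => by
    rw [SimpleGraph.card_neighborFinset_eq_degree]; exact hreg v
  let base : V → V → ℕ := fun u v => 1 + if m ≤ X u + X v then H else 0
  have hbase_symm : ∀ u v, base u v = base v u := fun u v => by simp only [base, add_comm]
  let η : V → ℕ := fun v => #{u ∈ G.neighborFinset v | m ≤ X v + X u}
  have hbase : ∀ v, ∑ u ∈ G.neighborFinset v, base v u = d + H * η v := by
    intro v
    simp only [base, Finset.sum_add_distrib, η]
    rw [Finset.sum_const, hdeg, ← Finset.sum_filter, Finset.sum_const]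
    simp [mul_comm]
  -- targets outside `C`
  set s : ℕ := d + H * d / m + K * d * (P + 1) / m + 3 with hs
  have hcount₀ : M.count (fun x => 3 ≤ x) = M - 3 := by
    rw [Nat.count_eq_card_filter_range, ← Nat.card_Ico]
    congr 1
    ext x
    simp [and_comm]
  have hcount₁ : M.count (fun x => x = 0) = 1 := by
    rw [Nat.count_eq_card_filter_range, Finset.card_eq_one]
    refine ⟨0, ?_⟩
    ext x
    simp only [Finset.mem_filter, Finset.mem_range, Finset.mem_singleton]
    omega
  obtain ⟨t₀, ht₀, hinj₀⟩ := exists_targets (Finset.univ : Finset V) X s (H * d) m K M hK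
    (fun x => 3 ≤ x) (fun i => by rw [hcount₀]; exact hcap₀ i)
  obtain ⟨t₁, ht₁, hinj₁⟩ := exists_targets A X s (H * d) m K M hK
    (fun x => x = 0) (fun i => by rw [hcount₁, mul_one]; exact hcap₁ i)
  let t : V → ℕ := fun v => if v ∈ A then t₁ v else t₀ v
  have ht : ∀ v, s + X v * (H * d) / m ≤ t v ∧ t v < s + X v * (H * d) / m + H * d / m := by
    intro v
    simp only [t]
    split_ifs with h
    · exact ⟨(ht₁ v h).1, (ht₁ v h).2.1⟩
    · exact ⟨(ht₀ v (Finset.mem_univ v)).1, (ht₀ v (Finset.mem_univ v)).2.1⟩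
  let κ : V → ℕ := fun v => #(G.neighborFinset v ∩ C)
  have hpre : ∀ v, d + H * η v + K * κ v ≤ t v ∧ t v ≤ d + H * η v + K * κ v + K * κ v := by
    intro v
    obtain ⟨h1, h2⟩ := ht v
    have a1 := Nat.div_mul_le_self (H * d) m
    have a2 := Nat.lt_div_mul_add (a := H * d) hm
    have b1 := Nat.div_mul_le_self (K * d * (P + 1)) m
    have b2 := Nat.lt_div_mul_add (a := K * d * (P + 1)) hm
    have c1 := Nat.div_mul_le_self (X v * (H * d)) m
    have c2 := Nat.lt_div_mul_add (a := X v * (H * d)) hm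
    have e1 := Nat.mul_le_mul_left H (hup v)
    have e2 := Nat.mul_le_mul_left H (hlo v)
    have e3 := Nat.mul_le_mul_left K (hCup v)
    have e4 := Nat.mul_le_mul_left K (hClo v)
    generalize H * d / m = q₁ at *
    generalize K * d * (P + 1) / m = q₂ at *
    generalize X v * (H * d) / m = q₃ at *
    change H * (m * η v) ≤ _ at e1
    change _ ≤ H * (m * η v + d) at e2
    change K * (m * κ v) ≤ _ at e3
    change _ ≤ K * (m * κ v + d) at e4
    constructor
    · apply Nat.le_of_mul_le_mul_left _ hm
      nlinarith [Nat.mul_le_mul_left m h1]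
    · apply Nat.le_of_mul_le_mul_left _ hm
      nlinarith [Nat.mul_le_mul_left m h2.le]
  have hcorr : ∀ a, ∃ f : V → ℕ, (∀ c, f c ≤ K) ∧
      ∑ c ∈ G.neighborFinset a ∩ C, f c = t a - (d + H * η a + K * κ a) := fun a =>
    exists_le_sum_eq K _ _ (by have := hpre a; simp only [κ] at this ⊢; omega)
  choose corr hcorrK hcorr using hcorr
  -- residues and toggles on `C`
  let W : V → V → Prop := fun c c' => X c ≤ X c' + w ∧ X c' ≤ X c + w
  let r : V → ℕ := fun c => d + H * η c + ∑ a ∈ G.neighborFinset c \ C, (K + corr a c)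
  have hCnbr : ∀ c ∈ C, ∃ c' ∈ C, G.Adj c c' := by
    intro c _
    have hP : 2 ≤ P := by
      by_contra hP
      have : K * d * P ≤ K * d * 1 := Nat.mul_le_mul_left _ (by omega)
      have : 0 < K * d := by positivity
      omega
    have hpos : 0 < #(G.neighborFinset c ∩ C) := by
      by_contra h
      have h0 : #(G.neighborFinset c ∩ C) = 0 := by omega
      have := hClo c
      rw [h0] at this
      nlinarith
    obtain ⟨c', hc'⟩ := Finset.card_pos.1 hpos
    rw [Finset.mem_inter, SimpleGraph.mem_neighborFinset] at hc'
    exact ⟨c', hc'.2, hc'.1⟩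
  obtain ⟨x, hxK, hx⟩ := exists_balanced_residues G C K B hK r W (fun u v h => ⟨h.2, h.1⟩)
    hCnbr hB
  let v : V → ℕ := fun c => r c + ∑ u ∈ G.neighborFinset c ∩ C, x s(c, u)
  have hvlo : ∀ c, d + H * η c ≤ v c := fun c => by simp only [v, r]; omega
  have hvup : ∀ c, v c ≤ d + H * η c + 2 * K * d := by
    intro c
    have h1 : ∑ a ∈ G.neighborFinset c \ C, (K + corr a c) ≤ #(G.neighborFinset c \ C) * (2 * K) :=
      Finset.sum_le_card_nsmul _ _ _ fun a _ => by have := hcorrK a c; omega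
    have h2 : ∑ u ∈ G.neighborFinset c ∩ C, x s(c, u) ≤ #(G.neighborFinset c ∩ C) * (2 * K) :=
      Finset.sum_le_card_nsmul _ _ _ fun a _ => by have := hxK s(c, a); omega
    have h3 : #(G.neighborFinset c \ C) + #(G.neighborFinset c ∩ C) = d := by
      rw [Finset.card_sdiff_add_card_inter, hdeg]
    simp only [v, r]
    have h4 : 2 * K * d = #(G.neighborFinset c \ C) * (2 * K) +
        #(G.neighborFinset c ∩ C) * (2 * K) := by rw [← add_mul, h3, mul_comm]
    omega
  have hfar : ∀ c c' : V, ∀ j j' : ℤ, |j| ≤ d → |j'| ≤ d →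
      (v c : ℤ) + K * j = v c' + K * j' → X c' ≤ X c + w := by
    intro c c' j j' hj hj' heq
    by_contra hcon
    push Not at hcon
    have e1 : (m : ℤ) * v c ≤ m * d + H * (d * (X c + 1)) + m * (2 * K * d) := by
      have h1 : m * v c ≤ m * (d + H * η c + 2 * K * d) := Nat.mul_le_mul_left _ (hvup c)
      have h2 := Nat.mul_le_mul_left H (hup c)
      change H * (m * η c) ≤ _ at h2
      have : m * v c ≤ m * d + H * (d * (X c + 1)) + m * (2 * K * d) := by linarith
      exact_mod_cast this
    have e2 : (m : ℤ) * d + H * (d * X c') ≤ m * v c' + H * d := by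
      have h1 : m * (d + H * η c') ≤ m * v c' := Nat.mul_le_mul_left _ (hvlo c')
      have h2 := Nat.mul_le_mul_left H (hlo c')
      change _ ≤ H * (m * η c' + d) at h2
      have : m * d + H * (d * X c') ≤ m * v c' + H * d := by linarith
      exact_mod_cast this
    have e3 : (v c' : ℤ) - v c = K * (j - j') := by linarith
    have e4 : j - j' ≤ 2 * d := by
      have := (abs_le.1 hj).2
      have := (abs_le.1 hj').1
      linarith
    have e5 : (m : ℤ) * (v c' - v c) ≤ m * (K * (2 * d)) := by
      rw [e3]; gcongr
    have e6 : (H : ℤ) * (d * (X c + w + 1)) ≤ H * (d * X c') := by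
      gcongr; exact_mod_cast hcon
    have e7 : ((2 * H + 4 * (K * m) : ℕ) : ℤ) * d < (H * (w + 1) : ℕ) * d := by
      exact_mod_cast Nat.mul_lt_mul_of_pos_right hw hd
    push_cast at e7
    linarith
  have hgpos : ∀ c ∈ C, #{c' ∈ C | c' ≠ c ∧ W c c' ∧ v c ≡ v c' [MOD K]} < g := by
    intro c hc
    have := (hx c hc).trans_lt hBg
    rw [mul_comm g] at this
    exact lt_of_mul_lt_mul_left this (Nat.zero_le K)
  obtain ⟨y, hy1, hy2, hy3, hy4, hy5⟩ := exists_toggles G A C (K := K) (M := M) (g := g) (D := d)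
    hK 2 (by omega) (fun c => (v c : ℤ)) (fun c c' => W c c' ∧ v c ≡ v c' [MOD K])
    (fun c => (hdeg c).le)
    (fun c _ c' _ _ j j' hj hj' heq => by
      refine ⟨⟨hfar c' c j' j hj' hj heq.symm, hfar c c' j j' hj hj' heq⟩, ?_⟩
      rw [← Int.natCast_modEq_iff]
      have h : (v c' : ℤ) - v c = K * (j - j') := by linarith
      exact Int.modEq_iff_dvd.2 ⟨_, h⟩)
    hgpos (fun c _ => hA c)
  -- the weighting
  let ex : V → V → ℤ := fun a c => K + corr a c + K * y a c
  have hex0 : ∀ a c, 0 ≤ ex a c ∧ ex a c ≤ 3 * K := by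
    intro a c
    have h1 := abs_le.1 (hy1 a c)
    have h2 : (corr a c : ℤ) ≤ K := by exact_mod_cast hcorrK a c
    have h3 : (0 : ℤ) ≤ K := by positivity
    have h4 : (0 : ℤ) ≤ corr a c := by positivity
    simp only [ex]
    have h5 := mul_le_mul_of_nonneg_left h1.1 h3
    have h6 := mul_le_mul_of_nonneg_left h1.2 h3
    constructor <;> linarith
  let wt : V → V → ℤ := fun u v => base u v +
    if u ∈ C then (if v ∈ C then (x s(u, v) : ℤ) else ex v u) else (if v ∈ C then ex u v else 0)
  have hwt_symm : ∀ u v, wt u v = wt v u := by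
    intro u v
    simp only [wt, hbase_symm u v, Sym2.eq_swap (a := u) (b := v)]
    by_cases hu : u ∈ C <;> by_cases hv : v ∈ C <;> simp [hu, hv]
  have hwt : ∀ u v, 1 ≤ wt u v ∧ wt u v ≤ 1 + H + 3 * K := by
    intro u v
    have h1 : (1 : ℤ) ≤ base u v ∧ (base u v : ℤ) ≤ 1 + H := by
      have : 1 ≤ base u v ∧ base u v ≤ 1 + H := by simp only [base]; split_ifs <;> omega
      exact_mod_cast this
    have h2 : (x s(u, v) : ℤ) < K := by exact_mod_cast hxK s(u, v)
    have h3 := hex0 u v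
    have h4 := hex0 v u
    simp only [wt]
    split_ifs <;> constructor <;> omega
  let ω : Sym2 V → ℕ := Sym2.lift ⟨fun u v => (wt u v).toNat, fun u v =>
    congrArg Int.toNat (hwt_symm u v)⟩
  have hω : ∀ u v, (ω s(u, v) : ℤ) = wt u v := by
    intro u v
    simp only [ω, Sym2.lift_mk]
    exact Int.toNat_of_nonneg (by linarith [(hwt u v).1])
  have hσ : ∀ u, (weightedDeg G ω u : ℤ) = ∑ u' ∈ G.neighborFinset u, wt u u' := by
    intro u; simp only [weightedDeg]; push_cast; simp only [hω]
  have hσA : ∀ a, a ∉ C → (weightedDeg G ω a : ℤ) = t a + K * ∑ c, y a c := by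
    intro a ha
    have h1 : ∑ c, y a c = ∑ c ∈ G.neighborFinset a ∩ C, y a c := by
      symm
      apply Finset.sum_subset (Finset.subset_univ _)
      intro c _ hc
      by_contra h
      have := hy2 a c h
      exact hc (by simp [this.2.1, this.2.2.symm])
    have h2 : (∑ u ∈ G.neighborFinset a, (base a u : ℤ)) = d + H * η a := by
      exact_mod_cast hbase a
    have h3 : (∑ c ∈ G.neighborFinset a ∩ C, (corr a c : ℤ)) =
        t a - (d + H * η a + K * κ a) := by
      have := hcorr a
      have h4 := (hpre a).1
      have h5 : ∑ c ∈ G.neighborFinset a ∩ C, corr a c + (d + H * η a + K * κ a) = t a := by omega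
      have h6 : (∑ c ∈ G.neighborFinset a ∩ C, (corr a c : ℤ)) +
        (d + H * η a + K * κ a) = t a := by exact_mod_cast h5
      linarith
    rw [hσ, h1]
    simp only [wt, if_neg ha, Finset.sum_add_distrib, h2]
    rw [Finset.sum_ite_mem]
    simp only [ex, Finset.sum_add_distrib, ← Finset.mul_sum, h3, Finset.sum_const, nsmul_eq_mul]
    simp only [κ]
    ring
  have hσC : ∀ c ∈ C, (weightedDeg G ω c : ℤ) = v c + K * ∑ a, y a c := by
    intro c hc
    have h1 : ∑ a, y a c = ∑ a ∈ G.neighborFinset c \ C, y a c := by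
      symm
      apply Finset.sum_subset (Finset.subset_univ _)
      intro a _ ha
      by_contra h
      have := hy2 a c h
      exact ha (by simp [this.2.2, Finset.disjoint_left.1 hAC this.1])
    have h2 : (∑ u ∈ G.neighborFinset c, (base c u : ℤ)) = d + H * η c := by
      exact_mod_cast hbase c
    rw [hσ, h1]
    simp only [wt, if_pos hc, Finset.sum_add_distrib, h2]
    rw [← Finset.sum_inter_add_sum_sdiff (G.neighborFinset c) C,
      Finset.sum_congr rfl fun u hu => if_pos (Finset.mem_inter.1 hu).2,
      Finset.sum_congr rfl fun u hu => if_neg (Finset.mem_sdiff.1 hu).2]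
    simp only [ex, v, r]
    push_cast
    simp only [Finset.sum_add_distrib, ← Finset.mul_sum]
    ring
  -- the three kinds of vertices live in different blocks
  have hzC : ∀ c ∈ C, weightedDeg G ω c / K % M = 2 := by
    intro c hc
    have h := hy4 c hc
    rw [← hσC c hc] at h
    exact_mod_cast h
  have hA₀ : ∀ a, a ∉ C → a ∉ A → weightedDeg G ω a = t₀ a := by
    intro a haC haA
    have h0 : ∑ c, y a c = 0 := Finset.sum_eq_zero fun c _ => by
      by_contra h
      exact haA (hy2 a c h).1
    have h := hσA a haC
    rw [h0, mul_zero, add_zero] at h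
    have ht : t a = t₀ a := if_neg haA
    rw [← ht]
    exact_mod_cast h
  have hA₁ : ∀ a ∈ A, (weightedDeg G ω a = t₁ a ∧ weightedDeg G ω a / K % M = 0) ∨
      (weightedDeg G ω a = t₁ a + K ∧ weightedDeg G ω a / K % M = 1) := by
    intro a haA
    have h := hσA a (Finset.disjoint_left.1 hAC haA)
    have ht : t a = t₁ a := if_pos haA
    have hz := (ht₁ a haA).2.2
    rw [ht] at h
    rcases hy3 a with h0 | h0
    · left
      rw [h0, mul_zero, add_zero] at h
      have h' : weightedDeg G ω a = t₁ a := by exact_mod_cast h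
      exact ⟨h', by rw [h']; exact hz⟩
    · right
      rw [h0, mul_one] at h
      have h' : weightedDeg G ω a = t₁ a + K := by exact_mod_cast h
      refine ⟨h', ?_⟩
      rw [h', Nat.add_div_right _ hK, Nat.add_mod, hz, zero_add,
        Nat.mod_mod, Nat.mod_eq_of_lt (by omega)]
  have hz₀ : ∀ a, a ∉ C → a ∉ A → 3 ≤ weightedDeg G ω a / K % M := by
    intro a haC haA
    rw [hA₀ a haC haA]
    exact (ht₀ a (Finset.mem_univ a)).2.2
  refine ⟨ω, fun e _ => ?_, fun a b hab heq => ?_⟩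
  · induction e using Sym2.ind with
    | _ a b =>
      have h1 := hω a b
      have h2 := hwt a b
      omega
  · by_cases haC : a ∈ C <;> by_cases hbC : b ∈ C
    · refine hy5 a haC b hbC hab ?_
      rw [← hσC a haC, ← hσC b hbC, heq]
    · have h1 := hzC a haC
      by_cases hbA : b ∈ A
      · have h2 := hA₁ b hbA
        rw [heq] at h1
        omega
      · have h2 := hz₀ b hbC hbA
        rw [heq] at h1
        omega
    · have h1 := hzC b hbC
      by_cases haA : a ∈ A
      · have h2 := hA₁ a haA
        rw [heq] at h2
        omega
      · have h2 := hz₀ a haC haA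
        rw [heq] at h2
        omega
    · by_cases haA : a ∈ A <;> by_cases hbA : b ∈ A
      · refine hab (hinj₁ haA hbA ?_)
        have h1 := hA₁ a haA
        have h2 := hA₁ b hbA
        rw [heq] at h1
        omega
      · have h1 := hA₁ a haA
        have h2 := hz₀ b hbC hbA
        rw [heq] at h1
        omega
      · have h1 := hA₁ b hbA
        have h2 := hz₀ a haC haA
        rw [heq] at h2
        omega
      · refine hab (hinj₀ (by simp) (by simp) ?_)
        rw [← hA₀ a haC haA, ← hA₀ b hbC hbA, heq]

/-- The number of pairs in `Fin a × Fin b` with prescribed properties of the coordinates. -/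
theorem card_filter_fin_prod (a b : ℕ) (p q : ℕ → Prop) [DecidablePred p] [DecidablePred q] :
    #{l : Fin a × Fin b | p l.1 ∧ q l.2} = #{x ∈ range a | p x} * #{x ∈ range b | q x} := by
  have hfin : ∀ (c : ℕ) (p : ℕ → Prop) [DecidablePred p],
      #{i : Fin c | p i} = #{x ∈ range c | p x} := by
    intro c p _
    rw [Finset.card_filter, Finset.card_filter]
    exact Fin.sum_univ_eq_sum_range (fun x => if p x then 1 else 0) c
  rw [← hfin, ← hfin, ← Finset.card_product]
  congr 1
  ext l
  simp

/-- A regular graph whose degree and order are not too small carries classes `X` and sets `A`, `C`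
with the same densities as random ones. -/
theorem exists_pseudorandom_classes {V : Type*} [Fintype V] [DecidableEq V] (G : SimpleGraph V)
    [DecidableRel G.Adj] {n d P : ℕ} (hcard : n = Fintype.card V) (hreg : G.IsRegularOfDegree d)
    (hP : 2 ≤ P) (hnP : 12 * P ^ 3 ≤ n) (hd : 12 * (P : ℝ) ^ 6 * Real.log n ≤ d)
    (hn : 12 * (P : ℝ) ^ 12 * Real.log n ≤ n) :
    ∃ (X : V → ℕ) (A C : Finset V), Disjoint A C ∧ (∀ v, X v < P ^ 3) ∧
      (∀ v, P ^ 3 * #{u ∈ G.neighborFinset v | P ^ 3 ≤ X v + X u} ≤ d * (X v + 1)) ∧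
      (∀ v, d * X v ≤ P ^ 3 * #{u ∈ G.neighborFinset v | P ^ 3 ≤ X v + X u} + d) ∧
      (∀ v, P ^ 3 * #(G.neighborFinset v ∩ C) ≤ d * (P + 1)) ∧
      (∀ v, d * P ≤ P ^ 3 * #(G.neighborFinset v ∩ C) + d) ∧
      (∀ v, d * P ^ 2 ≤ P ^ 3 * #(G.neighborFinset v ∩ A) + d) ∧
      (∀ i, P ^ 6 * #{v | X v = i} ≤ n * (P ^ 3 + 1)) ∧
      (∀ i, P ^ 4 * #{v ∈ A | X v = i} ≤ 2 * n) ∧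
      (∀ i, P ^ 5 * #{v ∈ C | X v = i} ≤ 2 * n) := by
  have hdeg : ∀ v, #(G.neighborFinset v) = d := fun v => by
    rw [SimpleGraph.card_neighborFinset_eq_degree]; exact hreg v
  have hP0 : 0 < P := by omega
  have hp : (2 : ℝ) ≤ P := by exact_mod_cast hP
  have hp3 : 0 < P ^ 3 := by positivity
  have hp2 : 0 < P ^ 2 := by positivity
  have hPP : P + 1 ≤ P ^ 2 := by nlinarith
  have : NeZero (P ^ 3) := ⟨hp3.ne'⟩
  have : NeZero (P ^ 2) := ⟨hp2.ne'⟩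
  let Λ := Fin (P ^ 3) × Fin (P ^ 2)
  let ι := Option V × Fin 3 × Fin (P ^ 3)
  -- the set of second coordinates defining `univ`, `C` and `A`
  let q : Fin 3 → ℕ → Prop := ![fun _ => True, fun x => x = 0, fun x => 1 ≤ x ∧ x ≤ P]
  let S : ι → Finset V := fun i => i.1.elim univ fun v => G.neighborFinset v
  let p : ι → ℕ → Prop := fun i x => i.1.elim (x = i.2.2) fun _ =>
    i.2.1 = 0 → P ^ 3 ≤ (i.2.2 : ℕ) + x
  classical
  let T : ι → Finset Λ := fun i => {l | p i l.1 ∧ q i.2.1 l.2}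
  let δ : ι → ℝ := fun i => i.1.elim (1 / (P : ℝ) ^ 6) fun _ => 1 / (P : ℝ) ^ 3
  have hδ0 : ∀ i, 0 ≤ δ i := by
    rintro ⟨_ | v, k⟩ <;> simp only [δ, Option.elim] <;> positivity
  have hδ1 : ∀ i, δ i ≤ 1 := by
    rintro ⟨_ | v, k⟩ <;> simp only [δ, Option.elim] <;>
      exact (div_le_one (by positivity)).2 (one_le_pow₀ (by linarith))
  have hn0 : 0 < n := by have : 0 < 12 * P ^ 3 := by positivity
                         omega
  have hnR : (0 : ℝ) < n := by exact_mod_cast hn0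
  have hexp : ∀ i, Real.exp (-(δ i ^ 2 * #(S i) / 4)) ≤ 1 / (n : ℝ) ^ 3 := by
    have key : 1 / (n : ℝ) ^ 3 = Real.exp (-(3 * Real.log n)) := by
      rw [Real.exp_neg, show (3 : ℝ) * Real.log n = ((3 : ℕ) : ℝ) * Real.log n by norm_num,
        Real.exp_nat_mul, Real.exp_log hnR, one_div]
    rw [key]
    rintro ⟨_ | v, k⟩ <;> simp only [δ, S, Option.elim, Real.exp_le_exp, neg_le_neg_iff]
    · rw [Finset.card_univ, ← hcard, div_pow, one_pow, ← pow_mul, div_mul_eq_mul_div, one_mul,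
        div_div, le_div_iff₀ (by positivity), show 6 * 2 = 12 from rfl]
      linarith
    · rw [hdeg, div_pow, one_pow, ← pow_mul, div_mul_eq_mul_div, one_mul,
        div_div, le_div_iff₀ (by positivity), show 3 * 2 = 6 from rfl]
      linarith
  have hsum : ∑ i, 2 * Real.exp (-(δ i ^ 2 * #(S i) / 4)) < 1 := by
    have h1 : ∑ i, 2 * Real.exp (-(δ i ^ 2 * #(S i) / 4)) ≤
        ∑ _i : ι, 2 * (1 / (n : ℝ) ^ 3) :=
      Finset.sum_le_sum fun i _ => mul_le_mul_of_nonneg_left (hexp i) (by norm_num)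
    refine h1.trans_lt ?_
    have hc : Fintype.card ι = (n + 1) * (3 * P ^ 3) := by
      simp only [ι, Fintype.card_prod, Fintype.card_option, Fintype.card_fin, hcard]
    rw [Finset.sum_const, Finset.card_univ, hc, nsmul_eq_mul, mul_one_div, mul_div_assoc',
      div_lt_one (by positivity)]
    have hn12 : 12 ≤ n := by nlinarith
    have : (n + 1) * (3 * P ^ 3) * 2 < n ^ 3 := by
      have h2 : (n + 1) * (3 * P ^ 3) * 2 ≤ (n + 1) * n := by nlinarith
      have h3 : (n + 1) * n < n ^ 3 := by nlinarith
      omega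
    exact_mod_cast this
  obtain ⟨f, hf⟩ := exists_forall_abs_card_sub_le S T δ hδ0 hδ1 hsum
  have hΛ : (Fintype.card Λ : ℝ) = (P : ℝ) ^ 5 := by
    simp only [Λ, Fintype.card_prod, Fintype.card_fin]
    push_cast
    ring
  have hTcard : ∀ i, #(T i) = #{x ∈ range (P ^ 3) | p i x} * #{x ∈ range (P ^ 2) | q i.2.1 x} :=
    fun i => card_filter_fin_prod _ _ _ _
  have hq0 : #{x ∈ range (P ^ 2) | q 0 x} = P ^ 2 := by simp [q]
  have hq1 : #{x ∈ range (P ^ 2) | q 1 x} = 1 := by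
    rw [Finset.card_eq_one]
    refine ⟨0, ?_⟩
    ext x
    simp only [q, mem_filter, mem_range, mem_singleton]
    simp
    omega
  have hq2 : #{x ∈ range (P ^ 2) | q 2 x} = P := by
    have : ({x ∈ range (P ^ 2) | q 2 x} : Finset ℕ) = Finset.Icc 1 P := by
      ext x
      simp only [q, mem_filter, mem_range, mem_Icc]
      simp
      omega
    rw [this, Nat.card_Icc]
    omega
  have hpnone : ∀ k j, #{x ∈ range (P ^ 3) | p (none, k, j) x} = 1 := by
    intro k j
    rw [Finset.card_eq_one]
    refine ⟨j, ?_⟩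
    ext x
    rw [mem_filter, mem_range, mem_singleton]
    change _ ∧ x = j ↔ _
    have := j.2
    omega
  have hpsome0 : ∀ v j, #{x ∈ range (P ^ 3) | p (some v, 0, j) x} = j := by
    intro v j
    have : ({x ∈ range (P ^ 3) | p (some v, 0, j) x} : Finset ℕ) =
        Finset.Ico (P ^ 3 - j) (P ^ 3) := by
      ext x
      simp only [p, Option.elim, mem_filter, mem_range, mem_Ico, forall_const]
      omega
    rw [this, Nat.card_Ico]
    have := j.2
    omega
  have hpsome : ∀ v k j, k ≠ 0 → #{x ∈ range (P ^ 3) | p (some v, k, j) x} = P ^ 3 := by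
    intro v k j hk
    simp [p, hk]
  let X : V → ℕ := fun v => (f v).1
  have hX : ∀ v, X v < P ^ 3 := fun v => (f v).1.2
  let A : Finset V := {v | q 2 (f v).2}
  let C : Finset V := {v | q 1 (f v).2}
  have hsome : ∀ v k j, |(#{u ∈ G.neighborFinset v | p (some v, k, j) (f u).1 ∧ q k (f u).2} : ℝ) -
      d * (#(T (some v, k, j)) / (P : ℝ) ^ 5)| ≤ 1 / (P : ℝ) ^ 3 * d := by
    intro v k j
    have h := hf (some v, k, j)
    rw [hΛ] at h
    simp only [S, Option.elim, δ, hdeg] at h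
    convert h using 6
    simp [T]
  have hnone : ∀ k (j : Fin (P ^ 3)), (#{u : V | X u = j ∧ q k (f u).2} : ℝ) ≤
      n * (#(T (none, k, j)) / (P : ℝ) ^ 5) + 1 / (P : ℝ) ^ 6 * n := by
    intro k j
    have h := hf (none, k, j)
    rw [hΛ] at h
    simp only [S, Option.elim, δ, Finset.card_univ, ← hcard] at h
    have h' := (abs_le.1 h).2
    have e : #{u : V | X u = j ∧ q k (f u).2} = #{u | f u ∈ T (none, k, j)} := by
      congr 1
      ext u
      rw [mem_filter, mem_filter, mem_filter]
      simp only [mem_univ, true_and]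
      rfl
    rw [e]
    linarith
  have hp0 : (0 : ℝ) < P := by linarith
  have hclass : ∀ k i, P ^ 6 * #{u : V | X u = i ∧ q k (f u).2} ≤
      n * (P * #{x ∈ range (P ^ 2) | q k x} + 1) := by
    intro k i
    by_cases hi : i < P ^ 3
    · have h := hnone k ⟨i, hi⟩
      rw [hTcard, hpnone, one_mul] at h
      have h' := mul_le_mul_of_nonneg_left h (by positivity : (0 : ℝ) ≤ (P : ℝ) ^ 6)
      have e : (P : ℝ) ^ 6 * (n * (#{x ∈ range (P ^ 2) | q k x} / (P : ℝ) ^ 5) +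
          1 / (P : ℝ) ^ 6 * n) = n * (P * #{x ∈ range (P ^ 2) | q k x} + 1) := by
        field_simp
      rw [e] at h'
      exact_mod_cast h'
    · have h : #{u : V | X u = i ∧ q k (f u).2} = 0 := by
        rw [Finset.card_eq_zero, Finset.filter_eq_empty_iff]
        intro u _ hu
        have := hX u
        omega
      rw [h, mul_zero]
      exact Nat.zero_le _
  have hnbr : ∀ v k (j : Fin (P ^ 3)),
      P ^ 3 * #{u ∈ G.neighborFinset v | p (some v, k, j) (f u).1 ∧ q k (f u).2} * P ^ 2 ≤
        d * (#(T (some v, k, j)) + P ^ 2) ∧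
      d * #(T (some v, k, j)) ≤ (P ^ 3 *
        #{u ∈ G.neighborFinset v | p (some v, k, j) (f u).1 ∧ q k (f u).2} + d) * P ^ 2 := by
    intro v k j
    have h := abs_le.1 (hsome v k j)
    have e1 : (P : ℝ) ^ 5 * (d * (#(T (some v, k, j)) / (P : ℝ) ^ 5)) =
        d * #(T (some v, k, j)) := by field_simp
    have e2 : (P : ℝ) ^ 5 * (1 / (P : ℝ) ^ 3 * d) = d * (P : ℝ) ^ 2 := by field_simp
    have h1 := mul_le_mul_of_nonneg_left h.1 (by positivity : (0 : ℝ) ≤ (P : ℝ) ^ 5)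
    have h2 := mul_le_mul_of_nonneg_left h.2 (by positivity : (0 : ℝ) ≤ (P : ℝ) ^ 5)
    rw [mul_neg, e2, mul_sub, e1] at h1
    rw [e2, mul_sub, e1] at h2
    constructor
    · rify
      linarith
    · rify
      linarith
  have hthr : ∀ v, #{u ∈ G.neighborFinset v | p (some v, 0, (f v).1) (f u).1 ∧ q 0 (f u).2} =
      #{u ∈ G.neighborFinset v | P ^ 3 ≤ X v + X u} := by
    intro v
    congr 1
    ext u
    simp [p, q, X]
  have hinter : ∀ v k, k ≠ 0 →
      #{u ∈ G.neighborFinset v | p (some v, k, (f v).1) (f u).1 ∧ q k (f u).2} =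
      #(G.neighborFinset v ∩ ({u | q k (f u).2} : Finset V)) := by
    intro v k hk
    congr 1
    ext u
    simp [p, hk]
  have hcls : ∀ k i, #{v ∈ ({u | q k (f u).2} : Finset V) | X v = i} =
      #{u : V | X u = i ∧ q k (f u).2} := by
    intro k i
    rw [Finset.filter_filter]
    simp only [and_comm]
  refine ⟨X, A, C, ?_, hX, fun v => ?_, fun v => ?_, fun v => ?_, fun v => ?_, fun v => ?_,
    fun i => ?_, fun i => ?_, fun i => ?_⟩
  · rw [Finset.disjoint_left]
    intro v h1 h2
    have h1' : 1 ≤ ((f v).2 : ℕ) := (mem_filter.1 h1).2.1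
    have h2' : ((f v).2 : ℕ) = 0 := (mem_filter.1 h2).2
    omega
  · have h := (hnbr v 0 (f v).1).1
    rw [hthr, hTcard, hpsome0, hq0] at h
    exact Nat.le_of_mul_le_mul_right (h.trans_eq (by ring)) hp2
  · have h := (hnbr v 0 (f v).1).2
    rw [hthr, hTcard, hpsome0, hq0] at h
    exact Nat.le_of_mul_le_mul_right (le_of_eq_of_le (by simp only [X]; ring) h) hp2
  · have h := (hnbr v 1 (f v).1).1
    rw [hinter v 1 (by decide), hTcard, hpsome _ _ _ (by decide), hq1] at h
    exact Nat.le_of_mul_le_mul_right (h.trans_eq (by ring)) hp2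
  · have h := (hnbr v 1 (f v).1).2
    rw [hinter v 1 (by decide), hTcard, hpsome _ _ _ (by decide), hq1] at h
    exact Nat.le_of_mul_le_mul_right (le_of_eq_of_le (by ring) h) hp2
  · have h := (hnbr v 2 (f v).1).2
    rw [hinter v 2 (by decide), hTcard, hpsome _ _ _ (by decide), hq2] at h
    exact Nat.le_of_mul_le_mul_right (le_of_eq_of_le (by ring) h) hp2
  · have h := hclass 0 i
    rw [hq0] at h
    have e : #{u : V | X u = i ∧ q 0 (f u).2} = #{u | X u = i} := by
      congr 1
      ext u
      simp [q]
    rw [e] at h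
    exact h.trans_eq (by ring)
  · have h := hclass 2 i
    rw [hq2, ← hcls] at h
    refine Nat.le_of_mul_le_mul_left ?_ hp2
    calc P ^ 2 * (P ^ 4 * _) = P ^ 6 * _ := by ring
      _ ≤ _ := h
      _ ≤ P ^ 2 * (2 * n) := by nlinarith
  · have h := hclass 1 i
    rw [hq1, ← hcls] at h
    refine Nat.le_of_mul_le_mul_left ?_ hP0
    calc P * (P ^ 5 * _) = P ^ 6 * _ := by ring
      _ ≤ _ := h
      _ ≤ P * (2 * n) := by nlinarith

set_option maxHeartbeats 1000000 in
/-- Parameters meeting the numerical requirements of `exists_irregular_weighting`. -/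
theorem exists_parameters {n d P : ℕ} {y : ℝ} (hy : 6 ≤ y) (hP : 1000 * y ≤ P)
    (hd : 12 * P ^ 6 ≤ d) (hn : 2 * y * d ≤ n) :
    ∃ K M H g w : ℕ, 0 < K ∧ 3 ≤ M ∧ P ^ 3 * (g * M) + d ≤ d * P ^ 2 ∧
      n * (P ^ 3 + 1) ≤ P ^ 6 * (H * d / P ^ 3 / (K * M) * (K * (M - 3))) ∧
      2 * n ≤ P ^ 4 * (H * d / P ^ 3 / (K * M) * K) ∧
      3 * (H * d) + 3 * P ^ 3 + 3 * (K * d) ≤ K * d * P ∧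
      2 * H + 4 * (K * P ^ 3) < H * (w + 1) ∧
      4 * ((2 * w + 1) * (2 * n / P ^ 5)) + K < g * K ∧
      ((1 + H + 3 * K : ℕ) : ℝ) ≤ (n : ℝ) / d * (1 + 8 / y) := by
  have hy0 : 0 < y := by linarith
  have hp : (6000 : ℝ) ≤ P := by linarith
  have hp0 : (0 : ℝ) < P := by linarith
  have hP0 : 0 < P := by exact_mod_cast hp0
  have hD : (12 : ℝ) * P ^ 6 ≤ d := by exact_mod_cast hd
  have hp6 : (1 : ℝ) ≤ (P : ℝ) ^ 6 := one_le_pow₀ (by linarith)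
  have hd0 : (0 : ℝ) < d := by linarith
  have hd0' : 0 < d := by exact_mod_cast hd0
  have hn0 : (0 : ℝ) < n := lt_of_lt_of_le (by positivity) hn
  set r : ℝ := n / d with hr
  have hrd : r * d = n := by rw [hr]; field_simp
  have hr2 : 2 * y ≤ r := by rw [hr, le_div_iff₀ hd0]; exact hn
  have hr0 : 0 < r := by linarith
  set ρ : ℝ := r / y with hρ
  have hρy : ρ * y = r := by rw [hρ]; field_simp
  have hρ2 : 2 ≤ ρ := by rw [hρ, le_div_iff₀ hy0]; exact hr2
  set K : ℕ := ⌊ρ⌋₊ with hK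
  have hK1 : (K : ℝ) ≤ ρ := Nat.floor_le (by linarith)
  have hK2 : ρ / 2 ≤ K := by have := Nat.lt_floor_add_one ρ; linarith
  have hK0 : (0 : ℝ) < K := by linarith
  set M : ℕ := ⌈2 * y⌉₊ with hM
  have hM1 : 2 * y ≤ M := Nat.le_ceil _
  have hM2 : (M : ℝ) ≤ 3 * y := by
    have := Nat.ceil_lt_add_one (show 0 ≤ 2 * y by linarith); linarith
  have hM0 : (0 : ℝ) < M := by linarith
  set H : ℕ := ⌈r + 4 * ρ⌉₊ with hH
  have hH1 : r + 4 * ρ ≤ H := Nat.le_ceil _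
  have hH2 : (H : ℝ) ≤ r + 4 * ρ + 1 := (Nat.ceil_lt_add_one (by positivity)).le
  have hρr : 6 * ρ ≤ r := by rw [← hρy]; nlinarith
  have hH3 : (H : ℝ) ≤ 3 * r := by linarith
  have hH0 : (0 : ℝ) < H := by linarith
  have hK0' : 0 < K := by exact_mod_cast hK0
  have hM3 : 3 ≤ M := by
    have : (3 : ℝ) ≤ M := by linarith
    exact_mod_cast this
  have hM0' : 0 < M := by omega
  have hH0' : 0 < H := by exact_mod_cast hH0
  have hp3 : (0 : ℝ) < (P : ℝ) ^ 3 := by positivity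
  have hp3' : 0 < P ^ 3 := by positivity
  have hP3 : (P : ℝ) ≤ (P : ℝ) ^ 3 := le_self_pow₀ (by linarith) (by norm_num)
  have hKM : (K : ℝ) * M ≤ 3 * r := by
    calc (K : ℝ) * M ≤ ρ * (3 * y) := mul_le_mul hK1 hM2 hM0.le (by linarith)
      _ = 3 * r := by rw [← hρy]; ring
  -- the capacity of a class
  set T : ℕ := H * d / P ^ 3 / (K * M) with hT
  have hTlow : (n : ℝ) + 7 / 2 * (ρ * d) ≤ T * (K * M) * P ^ 3 := by
    have h1 : H * d / P ^ 3 < T * (K * M) + K * M := Nat.lt_div_mul_add (by positivity)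
    have h2 : H * d < H * d / P ^ 3 * P ^ 3 + P ^ 3 := Nat.lt_div_mul_add hp3'
    have h3 : H * d < (T * (K * M) + K * M) * P ^ 3 :=
      h2.trans_le ((Nat.succ_mul _ _).symm.trans_le (Nat.mul_le_mul_right _ h1))
    have h4 : (H : ℝ) * d < (T * (K * M) + K * M) * P ^ 3 := by exact_mod_cast h3
    have h5 : (n : ℝ) + 4 * (ρ * d) ≤ H * d := by
      rw [← hrd, ← mul_assoc, ← add_mul]
      exact mul_le_mul_of_nonneg_right hH1 hd0.le
    have h6 : (K : ℝ) * M * P ^ 3 ≤ 1 / 2 * (ρ * d) := by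
      have h7 : (P : ℝ) ^ 3 * (12 * P) ≤ d := by
        calc (P : ℝ) ^ 3 * (12 * P) ≤ (P : ℝ) ^ 3 * (12 * (P : ℝ) ^ 3) := by gcongr
          _ = 12 * (P : ℝ) ^ 6 := by ring
          _ ≤ (d : ℝ) := hD
      have h8 : (P : ℝ) ^ 3 * (12 * (1000 * y)) ≤ d := le_trans (by gcongr) h7
      calc (K : ℝ) * M * P ^ 3 ≤ 3 * r * P ^ 3 := by gcongr
        _ = ρ * (3 * (P ^ 3 * y)) := by rw [← hρy]; ring
        _ ≤ ρ * (1 / 2 * d) := by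
          apply mul_le_mul_of_nonneg_left _ (by linarith)
          have : 0 ≤ (P : ℝ) ^ 3 * y := by positivity
          linarith
        _ = _ := by ring
    linarith
  set g : ℕ := d * (P ^ 2 - 1) / P ^ 3 / M with hg
  have hP2 : (1 : ℕ) ≤ P ^ 2 := Nat.one_le_pow _ _ hP0
  have hp2 : (1 : ℝ) ≤ (P : ℝ) ^ 2 := by exact_mod_cast hP2
  set w : ℕ := 4 * (K * P ^ 3) / H + 2 with hw
  refine ⟨K, M, H, g, w, hK0', hM3, ?_, ?_, ?_, ?_, ?_, ?_, ?_⟩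
  · have h1 : g * M ≤ d * (P ^ 2 - 1) / P ^ 3 := Nat.div_mul_le_self _ _
    have h2 : d * (P ^ 2 - 1) / P ^ 3 * P ^ 3 ≤ d * (P ^ 2 - 1) := Nat.div_mul_le_self _ _
    have h3 : d * (P ^ 2 - 1) + d = d * P ^ 2 := by
      rw [← Nat.mul_succ]
      congr 1
      omega
    have h4 := Nat.mul_le_mul_left (P ^ 3) h1
    linarith
  · have hsub : ((M - 3 : ℕ) : ℝ) = M - 3 := by push_cast [hM3]; ring
    have h1 : (1 + 1 / y) * (n : ℝ) ≤ T * (K * (M - 3)) * P ^ 3 := by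
      set u : ℝ := 1 / y with hu
      have huy : u * y = 1 := by rw [hu]; field_simp
      have hu0 : 0 < u := by positivity
      have hu6 : u ≤ 1 / 6 := one_div_le_one_div_of_le (by norm_num) hy
      have hρn : ρ * d = u * n := by rw [hu, hρ, ← hrd]; ring
      rw [hρn] at hTlow
      set S : ℝ := T * K * P ^ 3 with hS
      have hS0 : 0 ≤ S := by positivity
      have h2 : (n : ℝ) + 7 / 2 * (u * n) ≤ S * M := hTlow.trans_eq (by rw [hS]; ring)
      have h3 : S ≤ S * M * (u / 2) := by
        calc S = S * (2 * y) * (u / 2) := by linear_combination -S * huy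
          _ ≤ _ := by gcongr
      have h4 : ((n : ℝ) + 7 / 2 * (u * n)) * (1 - 3 / 2 * u) ≤ S * M * (1 - 3 / 2 * u) :=
        mul_le_mul_of_nonneg_right h2 (by linarith)
      have h5 : u * u * n ≤ 1 / 6 * u * n := by gcongr
      have h6 : 0 ≤ u * n := by positivity
      calc (1 + u) * (n : ℝ) ≤ ((n : ℝ) + 7 / 2 * (u * n)) * (1 - 3 / 2 * u) := by linarith
        _ ≤ S * M - 3 * S := by linarith
        _ = _ := by rw [hS]; ring
    have h2 : (n : ℝ) * (P ^ 3 + 1) ≤ P ^ 3 * ((1 + 1 / y) * n) := by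
      have h3 : 1 ≤ (P : ℝ) ^ 3 * (1 / y) := by
        rw [mul_one_div, one_le_div hy0]
        linarith
      calc (n : ℝ) * (P ^ 3 + 1) ≤ n * (P ^ 3 + P ^ 3 * (1 / y)) := by gcongr
        _ = _ := by ring
    have h3 : (n : ℝ) * (P ^ 3 + 1) ≤ P ^ 6 * (T * (K * (M - 3 : ℕ))) := by
      rw [hsub]
      calc _ ≤ _ := h2
        _ ≤ P ^ 3 * (T * (K * (M - 3)) * P ^ 3) := by gcongr
        _ = _ := by ring
    exact_mod_cast h3
  · have h1 : (2 : ℝ) * n ≤ P ^ 4 * (T * K) := by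
      have h2 : (n : ℝ) ≤ T * K * P ^ 3 * (3 * y) := by
        calc (n : ℝ) ≤ T * (K * M) * P ^ 3 := by
              have : 0 ≤ ρ * d := by positivity
              linarith
          _ = T * K * P ^ 3 * M := by ring
          _ ≤ _ := by gcongr
      have h3 : (0 : ℝ) ≤ T * K * P ^ 3 := by positivity
      calc (2 : ℝ) * n ≤ T * K * P ^ 3 * (6 * y) := by linarith
        _ ≤ T * K * P ^ 3 * P := by gcongr; linarith
        _ = _ := by ring
    exact_mod_cast h1
  · have h1 : 3 * ((H : ℝ) * d) + 3 * P ^ 3 + 3 * (K * d) ≤ K * d * P := by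
      have h2 : (H : ℝ) * d ≤ 3 * n := by
        rw [← hrd, ← mul_assoc]; gcongr
      have h3 : (P : ℝ) ^ 3 ≤ n := by
        calc (P : ℝ) ^ 3 ≤ P ^ 6 := pow_le_pow_right₀ (by linarith) (by norm_num)
          _ ≤ d := by linarith
          _ ≤ 2 * y * d := le_mul_of_one_le_left hd0.le (by linarith)
          _ ≤ n := hn
      have h4 : (12 : ℝ) * n ≤ K * d * (P - 3) := by
        calc (12 : ℝ) * n ≤ ρ / 2 * d * (24 * y) := by rw [← hrd, ← hρy]; linarith
          _ ≤ K * d * (P - 3) := by gcongr; linarith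
      linarith
    exact_mod_cast h1
  · have h1 : 4 * (K * P ^ 3) < 4 * (K * P ^ 3) / H * H + H := Nat.lt_div_mul_add hH0'
    rw [hw]
    linarith
  · set a : ℕ := 2 * n / P ^ 5 with ha
    have ha1 : (a : ℝ) * P ^ 5 ≤ 2 * n := by
      exact_mod_cast Nat.div_mul_le_self (2 * n) (P ^ 5)
    have hw1 : ((2 * w + 1 : ℕ) : ℝ) * H ≤ 8 * (K * P ^ 3) + 5 * H := by
      have h1 := Nat.div_mul_le_self (4 * (K * P ^ 3)) H
      have h2 : (2 * w + 1) * H ≤ 8 * (K * P ^ 3) + 5 * H := by rw [hw]; linarith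
      exact_mod_cast h2
    have hHK : (H : ℝ) ≤ K * P ^ 3 := by
      calc (H : ℝ) ≤ 3 * r := hH3
        _ = ρ / 2 * (6 * y) := by rw [← hρy]; ring
        _ ≤ K * P ^ 3 := by gcongr; linarith
    have hw2 : ((2 * w + 1 : ℕ) : ℝ) * r ≤ 13 * (K * P ^ 3) := by
      have h1 : ((2 * w + 1 : ℕ) : ℝ) * r ≤ ((2 * w + 1 : ℕ) : ℝ) * H := by gcongr; linarith
      linarith
    have hB : ((2 * w + 1 : ℕ) : ℝ) * a * P ^ 2 ≤ 26 * (K * d) := by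
      have h1 : ((2 * w + 1 : ℕ) : ℝ) * r * (a * P ^ 5) ≤ 13 * (K * P ^ 3) * (2 * n) := by gcongr
      refine le_of_mul_le_mul_right (a := r * (P : ℝ) ^ 3) ?_ (by positivity)
      calc ((2 * w + 1 : ℕ) : ℝ) * a * P ^ 2 * (r * P ^ 3)
          = ((2 * w + 1 : ℕ) : ℝ) * r * (a * P ^ 5) := by ring
        _ ≤ _ := h1
        _ = _ := by rw [← hrd]; ring
    have hg1 : 166 * (d : ℝ) ≤ (g + 1) * P ^ 2 := by
      have h1 : d * (P ^ 2 - 1) / P ^ 3 < g * M + M := Nat.lt_div_mul_add hM0'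
      have h2 : d * (P ^ 2 - 1) < d * (P ^ 2 - 1) / P ^ 3 * P ^ 3 + P ^ 3 :=
        Nat.lt_div_mul_add hp3'
      have h3 : d * (P ^ 2 - 1) < (g * M + M) * P ^ 3 :=
        h2.trans_le ((Nat.succ_mul _ _).symm.trans_le (Nat.mul_le_mul_right _ h1))
      have h4 : (d : ℝ) * (P ^ 2 - 1) < (g * M + M) * P ^ 3 := by
        have : ((P ^ 2 - 1 : ℕ) : ℝ) = (P : ℝ) ^ 2 - 1 := by push_cast [hP2]; ring
        rw [← this]
        exact_mod_cast h3
      have h5 : (d : ℝ) * (P ^ 2 / 2) ≤ d * (P ^ 2 - 1) := by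
        have : (2 : ℝ) ≤ (P : ℝ) ^ 2 :=
          le_trans (by linarith) (le_self_pow₀ (by linarith) two_ne_zero)
        gcongr
        linarith
      have h6 : ((g : ℝ) * M + M) * P ^ 3 ≤ (g + 1) * (3 * (P / 1000)) * P ^ 3 := by
        have : (M : ℝ) ≤ 3 * (P / 1000) := by linarith
        calc ((g : ℝ) * M + M) * P ^ 3 = (g + 1) * M * P ^ 3 := by ring
          _ ≤ _ := by gcongr
      refine le_of_mul_le_mul_right (a := (P : ℝ) ^ 2) ?_ (by positivity)
      have h7 : 0 ≤ (d : ℝ) * P ^ 2 := by positivity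
      have h8 : ((g : ℝ) + 1) * (3 * (P / 1000)) * P ^ 3 =
          3 / 1000 * ((g + 1) * P ^ 2 * P ^ 2) := by
        ring
      linarith
    have hPd : (P : ℝ) ^ 2 ≤ d := by
      have : (P : ℝ) ^ 2 ≤ P ^ 6 := pow_le_pow_right₀ (by linarith) (by norm_num)
      linarith
    have h1 : (4 : ℝ) * (((2 * w + 1 : ℕ) : ℝ) * a) + K < g * K := by
      refine lt_of_mul_lt_mul_right (a := (P : ℝ) ^ 2) ?_ (by positivity)
      calc (4 * (((2 * w + 1 : ℕ) : ℝ) * a) + K) * (P : ℝ) ^ 2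
          = 4 * (((2 * w + 1 : ℕ) : ℝ) * a * (P : ℝ) ^ 2) + K * (P : ℝ) ^ 2 := by ring
        _ ≤ 4 * (26 * ((K : ℝ) * d)) + K * (P : ℝ) ^ 2 := by gcongr
        _ = (K : ℝ) * (104 * d + (P : ℝ) ^ 2) := by ring
        _ < (K : ℝ) * (g * (P : ℝ) ^ 2) := by
          apply mul_lt_mul_of_pos_left _ hK0
          linarith
        _ = _ := by ring
    exact_mod_cast h1
  · push_cast
    have : r * (1 + 8 / y) = r + 8 * ρ := by rw [hρ]; ring
    rw [this]
    linarith

/-- The upper bound on the irregularity strength under explicit assumptions on the sizes. -/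
theorem irregularityStrength_le {V : Type} [Fintype V] (G : SimpleGraph V) [DecidableRel G.Adj]
    {n d P : ℕ} {y : ℝ} (hcard : n = Fintype.card V) (hreg : G.IsRegularOfDegree d)
    (hy : 6 ≤ y) (hP : 1000 * y ≤ P) (hlog : 1 ≤ Real.log n)
    (hd : 12 * (P : ℝ) ^ 6 * Real.log n ≤ d) (hn : 12 * (P : ℝ) ^ 12 * Real.log n ≤ n)
    (hdn : 2 * y * d ≤ n) :
    (irregularityStrength G : ℝ) ≤ (n : ℝ) / d * (1 + 8 / y) := by
  classical
  have hp : (6000 : ℝ) ≤ P := by linarith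
  have hP2 : 2 ≤ P := by
    have : (2 : ℝ) ≤ P := by linarith
    exact_mod_cast this
  have hp3 : 0 < P ^ 3 := by positivity
  have hnP : 12 * P ^ 3 ≤ n := by
    have h1 : (12 : ℝ) * (P : ℝ) ^ 3 ≤ n := by
      calc (12 : ℝ) * (P : ℝ) ^ 3 ≤ 12 * (P : ℝ) ^ 12 * 1 := by
            rw [mul_one]
            gcongr
            · linarith
            · norm_num
        _ ≤ 12 * (P : ℝ) ^ 12 * Real.log n := by gcongr
        _ ≤ n := hn
    exact_mod_cast h1
  have hdP : 12 * P ^ 6 ≤ d := by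
    have h1 : (12 : ℝ) * (P : ℝ) ^ 6 ≤ d :=
      le_trans (le_mul_of_one_le_right (by positivity) hlog) hd
    exact_mod_cast h1
  have hd0 : 0 < d := lt_of_lt_of_le (by positivity) hdP
  obtain ⟨X, A, C, hAC, -, hup, hlo, hCup, hClo, hA, hcls, hclsA, hclsC⟩ :=
    exists_pseudorandom_classes G hcard hreg hP2 hnP hd hn
  obtain ⟨K, M, H, g, w, hK, hM, hg, hcap₀, hcap₁, hroom, hw, hB, hle⟩ :=
    exists_parameters hy hP hdP hdn
  have hwin : ∀ c ∈ C, #{c' ∈ C | X c ≤ X c' + w ∧ X c' ≤ X c + w} ≤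
      (2 * w + 1) * (2 * n / P ^ 5) := by
    intro c _
    have h1 : #{c' ∈ C | X c ≤ X c' + w ∧ X c' ≤ X c + w} ≤
        (2 * n / P ^ 5) * #(Finset.Icc (X c - w) (X c + w)) := by
      refine Finset.card_le_mul_card_image_of_maps_to (f := X) (fun c' hc' => ?_) _ fun i _ => ?_
      · rw [mem_filter] at hc'
        rw [mem_Icc]
        omega
      · refine le_trans (Finset.card_le_card (Finset.filter_subset_filter _ (filter_subset _ _))) ?_
        rw [Nat.le_div_iff_mul_le (by positivity), mul_comm]
        exact hclsC i
    refine h1.trans ?_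
    rw [mul_comm, Nat.card_Icc]
    exact Nat.mul_le_mul_right _ (by omega)
  have hmem : 1 + H + 3 * K ∈ {k : ℕ | ∃ ω : Sym2 V → ℕ, (∀ e ∈ G.edgeSet, 1 ≤ ω e ∧ ω e ≤ k) ∧
      ∀ u v : V, u ≠ v → weightedDeg G ω u ≠ weightedDeg G ω v} := by
    refine exists_irregular_weighting G (P := P) (g := g) hreg X A C hAC hd0 hp3 hK hM hup hlo hCup
      hClo (fun v => ?_) (fun i => ?_) (fun i => ?_) hroom hw hwin hB
    · have h1 := hA v
      have h2 : g * M ≤ #(G.neighborFinset v ∩ A) :=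
        Nat.le_of_mul_le_mul_left (by omega) hp3
      omega
    · exact Nat.le_of_mul_le_mul_left ((hcls i).trans hcap₀) (by positivity)
    · exact Nat.le_of_mul_le_mul_left ((hclsA i).trans hcap₁) (by positivity)
  refine le_trans ?_ hle
  exact_mod_cast Nat.sInf_le hmem

theorem faudree_lehel_asymptotic (b ε : ℝ) (hb : 0 < b) (hε : 0 < ε) :
    ∃ N : ℕ, ∀ (V : Type) [Fintype V] (G : SimpleGraph V) [DecidableRel G.Adj] (n d : ℕ),
      n = Fintype.card V → G.IsRegularOfDegree d → N ≤ n →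
      Real.log n ^ (1 + 6 * b + 12 * ε) ≤ (d : ℝ) →
      (d : ℝ) ≤ (n : ℝ) / Real.log n ^ (2 * b + 5 * ε) →
      (irregularityStrength G : ℝ) ≤ ((n : ℝ) / (d : ℝ)) * (1 + 8 / Real.log n ^ b) := by
  have hlarge : ∀ᶠ L : ℝ in Filter.atTop, 1 ≤ L ∧ 6 ≤ L ^ b ∧ 1000 ≤ L ^ ε ∧
      L ^ (1 + 12 * (b + ε)) ≤ 1 / 50000 * Real.exp L := by
    filter_upwards [Filter.eventually_ge_atTop 1,
      (tendsto_rpow_atTop hb).eventually_ge_atTop 6,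
      (tendsto_rpow_atTop hε).eventually_ge_atTop 1000,
      (isLittleO_rpow_exp_pos_mul_atTop (1 + 12 * (b + ε)) one_pos).bound
        (by norm_num : (0 : ℝ) < 1 / 50000)] with L h1 h2 h3 h4
    refine ⟨h1, h2, h3, ?_⟩
    rw [one_mul] at h4
    rwa [Real.norm_of_nonneg (by positivity), Real.norm_of_nonneg (by positivity)] at h4
  obtain ⟨N, hN⟩ := Filter.eventually_atTop.1
    ((Real.tendsto_log_atTop.comp tendsto_natCast_atTop_atTop).eventually hlarge)
  refine ⟨max N 1, fun V _ G _ n d hcard hreg hn hd₁ hd₂ => ?_⟩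
  obtain ⟨hL1, hy, hz, hexp⟩ := hN n (le_of_max_le_left hn)
  have hn0 : (0 : ℝ) < n := by exact_mod_cast le_of_max_le_right hn
  simp only [Function.comp_apply] at hL1 hy hz hexp
  rw [Real.exp_log hn0] at hexp
  set L := Real.log n with hL
  have hL0 : 0 < L := by linarith
  set P := ⌈L ^ (b + ε)⌉₊ with hP
  have hyz : L ^ (b + ε) = L ^ b * L ^ ε := Real.rpow_add hL0 b ε
  have hP1 : L ^ (b + ε) ≤ P := Nat.le_ceil _
  have hP2 : (P : ℝ) ≤ 2 * L ^ (b + ε) := by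
    have h1 := Nat.ceil_lt_add_one (show 0 ≤ L ^ (b + ε) by positivity)
    have h2 : 1 ≤ L ^ (b + ε) := Real.one_le_rpow hL1 (by positivity)
    linarith
  have hpow : ∀ k : ℕ, (P : ℝ) ^ k * L ≤ 2 ^ k * L ^ (1 + k * (b + ε)) := by
    intro k
    calc (P : ℝ) ^ k * L ≤ (2 * L ^ (b + ε)) ^ k * L := by gcongr
      _ = 2 ^ k * L ^ (1 + k * (b + ε)) := by
        rw [mul_pow, Real.rpow_add hL0 1, Real.rpow_one, mul_comm (k : ℝ), Real.rpow_mul hL0.le,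
          Real.rpow_natCast]
        ring
  refine irregularityStrength_le G (P := P) hcard hreg hy ?_ hL1 ?_ ?_ ?_
  · calc 1000 * L ^ b ≤ L ^ ε * L ^ b := by gcongr
      _ = L ^ (b + ε) := by rw [hyz, mul_comm]
      _ ≤ P := hP1
  · have h1 := hpow 6
    have h2 : L ^ (1 + 6 * b + 12 * ε) = L ^ (1 + 6 * (b + ε)) * L ^ (6 * ε) := by
      rw [← Real.rpow_add hL0]
      congr 1
      ring
    have h3 : 1000 ≤ L ^ (6 * ε) :=
      hz.trans (Real.rpow_le_rpow_of_exponent_le hL1 (by linarith))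
    have h4 : L ^ (1 + 6 * (b + ε)) * 1000 ≤ L ^ (1 + 6 * (b + ε)) * L ^ (6 * ε) := by gcongr
    have h5 : 0 ≤ L ^ (1 + 6 * (b + ε)) := by positivity
    push_cast at h1
    linarith
  · have h1 := hpow 12
    push_cast at h1
    linarith
  · have h1 : 2 * L ^ b ≤ L ^ (2 * b + 5 * ε) := by
      calc 2 * L ^ b ≤ L ^ ε * L ^ b := by gcongr; linarith
        _ = L ^ (b + ε) := by rw [hyz, mul_comm]
        _ ≤ _ := Real.rpow_le_rpow_of_exponent_le hL1 (by linarith)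
    rw [le_div_iff₀ (by positivity)] at hd₂
    calc 2 * L ^ b * d ≤ L ^ (2 * b + 5 * ε) * d := by gcongr
      _ ≤ n := by rwa [mul_comm]
end

section
/- There exists a constant N such that for every d-regular simple graph G with n vertices, where n ≥ N and ln^8 n ≤ d ≤ n / ln^3 n, the irregularity strength of G satisfies s(G) ≤ (n/d)·(1 + 8/ln n). -/
open Finset

/-- A vertex set that can be built up from the empty set by adding either two new adjacent vertices
or one new vertex adjacent to a vertex already present. -/
inductive EdgeBuilt {V : Type*} [DecidableEq V] (H : SimpleGraph V) : Finset V → Prop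
  | empty : EdgeBuilt H ∅
  | pair {W : Finset V} {a b : V} : EdgeBuilt H W → a ∉ W → b ∉ W → H.Adj a b →
      EdgeBuilt H (insert a (insert b W))
  | single {W : Finset V} {a b : V} : EdgeBuilt H W → a ∉ W → b ∈ W → H.Adj a b →
      EdgeBuilt H (insert a W)

theorem EdgeBuilt.of_forall_exists_adj {V : Type*} [DecidableEq V] (H : SimpleGraph V)
    (S : Finset V) (hS : ∀ v ∈ S, ∃ u ∈ S, H.Adj v u) : EdgeBuilt H S := by
  classical
  obtain ⟨W, hW, hmax⟩ := exists_max_image {W ∈ S.powerset | EdgeBuilt H W} card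
    ⟨∅, by simp [EdgeBuilt.empty]⟩
  simp only [mem_filter, mem_powerset] at hW hmax
  rcases eq_or_ne W S with rfl | hne
  · exact hW.2
  obtain ⟨v, hvS, hvW⟩ := exists_of_ssubset (hW.1.ssubset_of_ne hne)
  obtain ⟨u, huS, huv⟩ := hS v hvS
  exfalso
  by_cases hu : u ∈ W
  · have := hmax (insert v W) ⟨insert_subset hvS hW.1, hW.2.single hvW hu huv⟩
    rw [card_insert_of_notMem hvW] at this
    omega
  · have := hmax (insert v (insert u W))
      ⟨insert_subset hvS (insert_subset huS hW.1), hW.2.pair hvW hu huv⟩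
    rw [card_insert_of_notMem (by simp [hvW, huv.ne]), card_insert_of_notMem hu] at this
    omega

theorem card_heavy_residues_mul_le {V : Type*} (p T c : ℕ) [NeZero p] (P : Finset V)
    (f : V → ZMod p) (t : ZMod p) (hP : #P ≤ c) :
    #{x : ZMod p | T ≤ #{v ∈ P | f v = t + x}} * T ≤ c := by
  have h1 : #P = ∑ x : ZMod p, #{v ∈ P | f v - t = x} :=
    card_eq_sum_card_fiberwise (fun _ _ => mem_univ _)
  have h2 : #{x : ZMod p | T ≤ #{v ∈ P | f v = t + x}} • T ≤
      ∑ x ∈ {x : ZMod p | T ≤ #{v ∈ P | f v = t + x}}, #{v ∈ P | f v - t = x} := by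
    refine card_nsmul_le_sum _ _ _ fun x hx => ?_
    simpa [sub_eq_iff_eq_add'] using hx
  have h3 := sum_le_sum_of_subset (f := fun x : ZMod p => #{v ∈ P | f v - t = x})
    (subset_univ {x : ZMod p | T ≤ #{v ∈ P | f v = t + x}})
  rw [smul_eq_mul] at h2
  omega

theorem exists_light_residue {V : Type*} (p T c : ℕ) [NeZero p] (hT : 2 * c < p * T)
    (P Q : Finset V) (hP : #P ≤ c) (hQ : #Q ≤ c) (f : V → ZMod p) (s t : ZMod p) :
    ∃ x : ZMod p, #{v ∈ P | f v = s + x} < T ∧ #{v ∈ Q | f v = t + x} < T := by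
  classical
  by_contra! hcon
  have h : (univ : Finset (ZMod p)) ⊆ ({x : ZMod p | T ≤ #{v ∈ P | f v = s + x}} : Finset _) ∪
      ({x : ZMod p | T ≤ #{v ∈ Q | f v = t + x}} : Finset _) := by
    intro x _
    simp only [mem_union, mem_filter, mem_univ, true_and]
    by_contra! h
    exact absurd (hcon x h.1) (not_le.2 h.2)
  have h1 := (card_le_card h).trans (card_union_le _ _)
  rw [card_univ, ZMod.card] at h1
  have h2 := card_heavy_residues_mul_le p T c P f s hP
  have h3 := card_heavy_residues_mul_le p T c Q f t hQ
  nlinarith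

theorem EdgeBuilt.exists_balanced_residues {V ι : Type*} [Fintype V] [DecidableEq V]
    [DecidableEq ι] (H : SimpleGraph V) [DecidableRel H.Adj] (κ : V → ι) (p T c : ℕ) [NeZero p]
    (hT : 2 * c < p * T) (S : Finset V) (hc : ∀ j, #{v ∈ S | κ v = j} ≤ c) {W : Finset V}
    (hW : EdgeBuilt H W) : ∀ (P : Finset V) (f : V → ℤ), P ⊆ S → W ⊆ S → Disjoint P W →
    (∀ j (r : ZMod p), #{v ∈ P | κ v = j ∧ (f v : ZMod p) = r} ≤ T + 1) →
    ∃ w : V → V → ℤ, (∀ u v, w u v = w v u) ∧ (∀ u v, 0 ≤ w u v ∧ w u v < p) ∧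
      (∀ u v, w u v ≠ 0 → u ∈ W ∧ v ∈ W) ∧
      ∀ j (r : ZMod p), #{v ∈ P ∪ W | κ v = j ∧
        ((f v + ∑ u ∈ H.neighborFinset v, w v u : ℤ) : ZMod p) = r} ≤ T + 1 := by
  have hp : 0 < p := Nat.pos_of_neZero p
  -- adding weight `x` on the edge `ab` on top of a weighting that is zero at `a`
  have glue : ∀ (W₀ : Finset V) (a b : V) (x : ℤ) (w : V → V → ℤ), 0 ≤ x → x < p → H.Adj a b →
      a ∉ W₀ → (∀ u v, w u v = w v u) → (∀ u v, 0 ≤ w u v ∧ w u v < p) →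
      (∀ u v, w u v ≠ 0 → u ∈ W₀ ∧ v ∈ W₀) →
      ∃ w' : V → V → ℤ, (∀ u v, w' u v = w' v u) ∧ (∀ u v, 0 ≤ w' u v ∧ w' u v < p) ∧
        (∀ u v, w' u v ≠ 0 → u ∈ insert a (insert b W₀) ∧ v ∈ insert a (insert b W₀)) ∧
        ∀ v, ∑ u ∈ H.neighborFinset v, w' v u =
          (if v = a ∨ v = b then x else 0) + ∑ u ∈ H.neighborFinset v, w v u := by
    intro W₀ a b x w hx0 hx hab haW hsymm hw hsupp
    have hne := hab.ne
    have hwa : ∀ u, w a u = 0 := fun u => by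
      by_contra h; exact haW (hsupp a u h).1
    have hwa' : ∀ u, w u a = 0 := fun u => by rw [hsymm, hwa]
    refine ⟨fun u v => w u v + if (u = a ∧ v = b) ∨ (u = b ∧ v = a) then x else 0,
      ?_, ?_, ?_, ?_⟩
    · intro u v
      simp only [hsymm u v]
      congr 2
      apply propext; tauto
    · intro u v
      have := hw u v
      dsimp only
      split_ifs with h
      · rcases h with ⟨rfl, rfl⟩ | ⟨rfl, rfl⟩ <;> simp [hwa, hwa', hx, hx0]
      · simpa using this
    · intro u v h
      dsimp only at h
      by_cases h' : (u = a ∧ v = b) ∨ (u = b ∧ v = a)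
      · rcases h' with ⟨rfl, rfl⟩ | ⟨rfl, rfl⟩ <;> simp
      · rw [if_neg h', add_zero] at h
        have := hsupp u v h
        simp [this.1, this.2]
    · intro v
      rw [sum_add_distrib, add_comm]
      congr 1
      rcases eq_or_ne v a with rfl | hva
      · simp [hne, hab]
      · rcases eq_or_ne v b with rfl | hvb
        · simp [hva, sum_ite_eq', hab.symm]
        · simp [hva, hvb]
  have light : ∀ (P : Finset V) (f : V → ℤ) (a b : V), P ⊆ S → ∃ x : ℤ, 0 ≤ x ∧ x < p ∧
      #{v ∈ P | κ v = κ a ∧ (f v : ZMod p) = ((f a + x : ℤ) : ZMod p)} < T ∧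
      #{v ∈ P | κ v = κ b ∧ (f v : ZMod p) = ((f b + x : ℤ) : ZMod p)} < T := by
    intro P f a b hP
    obtain ⟨x, h1, h2⟩ := exists_light_residue p T c hT {v ∈ P | κ v = κ a} {v ∈ P | κ v = κ b}
      ((card_le_card (filter_subset_filter _ hP)).trans (hc _))
      ((card_le_card (filter_subset_filter _ hP)).trans (hc _)) (fun v => (f v : ZMod p)) (f a)
      (f b)
    rw [filter_filter] at h1 h2
    exact ⟨x.val, by positivity, by exact_mod_cast ZMod.val_lt x, by simpa using h1,
      by simpa using h2⟩
  induction hW with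
  | empty =>
    intro P f _ _ _ hload
    exact ⟨fun _ _ => 0, by simp, by simp [hp], by simp, by simpa using hload⟩
  | @pair W₀ a b hW₀ ha hb hab ih =>
    intro P f hPS hWS hdisj hload
    obtain ⟨x, hx0, hx, hxa, hxb⟩ := light P f a b hPS
    have haP : a ∉ P := fun h => disjoint_left.1 hdisj h (by simp)
    have hbP : b ∉ P := fun h => disjoint_left.1 hdisj h (by simp)
    obtain ⟨f', hf'⟩ : ∃ f' : V → ℤ, ∀ v, f' v = f v + if v = a ∨ v = b then x else 0 :=
      ⟨_, fun _ => rfl⟩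
    have hadd : ∀ v ∈ P, f' v = f v := by
      intro v hv
      have h1 : v ≠ a := by rintro rfl; exact haP hv
      have h2 : v ≠ b := by rintro rfl; exact hbP hv
      simp [hf', h1, h2]
    have hfa : f' a = f a + x := by simp [hf']
    have hfb : f' b = f b + x := by simp [hf']
    obtain ⟨w, hsymm, hw, hsupp, hfin⟩ := ih (insert a (insert b P)) f'
      (by
        have := insert_subset_iff.1 hWS
        exact insert_subset this.1 (insert_subset (insert_subset_iff.1 this.2).1 hPS))
      (fun v hv => hWS (by simp [hv]))
      (by
        simp only [disjoint_insert_left]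
        exact ⟨ha, hb, hdisj.mono_right fun v hv => by simp [hv]⟩)
      (by
        intro j r
        have hP : ({v ∈ P | κ v = j ∧ (f' v : ZMod p) = r} : Finset V) =
            {v ∈ P | κ v = j ∧ (f v : ZMod p) = r} :=
          filter_congr fun v hv => by rw [hadd v hv]
        rw [filter_insert, filter_insert, hP]
        have h1 := hload j r
        have e1 := card_insert_le a (insert b {v ∈ P | κ v = j ∧ (f v : ZMod p) = r})
        have e2 := card_insert_le a ({v ∈ P | κ v = j ∧ (f v : ZMod p) = r})
        have e3 := card_insert_le b ({v ∈ P | κ v = j ∧ (f v : ZMod p) = r})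
        have ha' : (κ a = j ∧ (f' a : ZMod p) = r) →
            #{v ∈ P | κ v = j ∧ (f v : ZMod p) = r} < T := by
          rintro ⟨rfl, rfl⟩
          rwa [hfa]
        have hb' : (κ b = j ∧ (f' b : ZMod p) = r) →
            #{v ∈ P | κ v = j ∧ (f v : ZMod p) = r} < T := by
          rintro ⟨rfl, rfl⟩
          rwa [hfb]
        split_ifs with c1 c2 c2
        · have := ha' c1; omega
        · have := ha' c1; omega
        · have := hb' c2; omega
        · exact h1)
    obtain ⟨w', h1, h2, h3, h4⟩ := glue W₀ a b x w hx0 hx hab ha hsymm hw hsupp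
    refine ⟨w', h1, h2, h3, fun j r => ?_⟩
    simp only [h4, ← add_assoc, ← hf']
    have : P ∪ insert a (insert b W₀) = insert a (insert b P) ∪ W₀ := by grind
    rw [this]
    exact hfin j r
  | @single W₀ a b hW₀ ha hb hab ih =>
    intro P f hPS hWS hdisj hload
    obtain ⟨x, hx0, hx, hxa, -⟩ := light P f a a hPS
    have haP : a ∉ P := fun h => disjoint_left.1 hdisj h (by simp)
    have hbP : b ∉ P := fun h => disjoint_left.1 hdisj h (by simp [hb])
    obtain ⟨f', hf'⟩ : ∃ f' : V → ℤ, ∀ v, f' v = f v + if v = a ∨ v = b then x else 0 :=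
      ⟨_, fun _ => rfl⟩
    have hadd : ∀ v ∈ P, f' v = f v := by
      intro v hv
      have h1 : v ≠ a := by rintro rfl; exact haP hv
      have h2 : v ≠ b := by rintro rfl; exact hbP hv
      simp [hf', h1, h2]
    have hfa : f' a = f a + x := by simp [hf']
    obtain ⟨w, hsymm, hw, hsupp, hfin⟩ := ih (insert a P) f'
      (insert_subset (insert_subset_iff.1 hWS).1 hPS)
      (fun v hv => hWS (by simp [hv]))
      (by
        simp only [disjoint_insert_left]
        exact ⟨ha, hdisj.mono_right fun v hv => by simp [hv]⟩)
      (by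
        intro j r
        have hP : ({v ∈ P | κ v = j ∧ (f' v : ZMod p) = r} : Finset V) =
            {v ∈ P | κ v = j ∧ (f v : ZMod p) = r} :=
          filter_congr fun v hv => by rw [hadd v hv]
        rw [filter_insert, hP]
        have h1 := hload j r
        have e2 := card_insert_le a ({v ∈ P | κ v = j ∧ (f v : ZMod p) = r})
        have ha' : (κ a = j ∧ (f' a : ZMod p) = r) →
            #{v ∈ P | κ v = j ∧ (f v : ZMod p) = r} < T := by
          rintro ⟨rfl, rfl⟩
          rwa [hfa]
        split_ifs with c1
        · have := ha' c1; omega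
        · exact h1)
    obtain ⟨w', h1, h2, h3, h4⟩ := glue W₀ a b x w hx0 hx hab ha hsymm hw hsupp
    have hins : insert b W₀ = W₀ := insert_eq_of_mem hb
    refine ⟨w', h1, h2, by rwa [hins] at h3, fun j r => ?_⟩
    simp only [h4, ← add_assoc, ← hf']
    have : P ∪ insert a W₀ = insert a P ∪ W₀ := by grind
    rw [this]
    exact hfin j r

/-- Edge weights in `{0, …, 3}` for which the halved shifted degrees `k v` are pairwise distinct on
each color class inside `S`, provided color classes are small compared to degrees. -/
theorem exists_step_weights {V ι : Type*} [Fintype V] [DecidableEq V] [DecidableEq ι]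
    (H : SimpleGraph V) [DecidableRel H.Adj] (χ : V → ι) (y : V → ℤ) (S : Finset V) (δ T : ℕ)
    (hdeg : ∀ v ∈ S, δ ≤ #(H.neighborFinset v)) (hT : 2 * T < δ)
    (hload : ∀ v ∈ S, #{u ∈ S | χ u = χ v} ≤ T) :
    ∃ (z : V → V → ℤ) (k : V → ℤ), (∀ u v, z u v = z v u) ∧
      (∀ u v, 0 ≤ z u v ∧ z u v ≤ 3) ∧
      (∀ v ∈ S, y v + ∑ u ∈ H.neighborFinset v, z v u = 2 * k v ∨
        y v + ∑ u ∈ H.neighborFinset v, z v u = 2 * k v + 1) ∧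
      ∀ u ∈ S, ∀ v ∈ S, χ u = χ v → k u = k v → u = v := by
  suffices h : ∀ P : Finset V, P ⊆ S → ∃ (z : V → V → ℤ) (k : V → ℤ), (∀ u v, z u v = z v u) ∧
      (∀ u v, 0 ≤ z u v ∧ z u v ≤ 3) ∧ (∀ u v, u ∉ P → 1 ≤ z u v ∧ z u v ≤ 2) ∧
      (∀ v ∈ P, y v + ∑ u ∈ H.neighborFinset v, z v u = 2 * k v ∨
        y v + ∑ u ∈ H.neighborFinset v, z v u = 2 * k v + 1) ∧
      ∀ u ∈ P, ∀ v ∈ P, χ u = χ v → k u = k v → u = v by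
    obtain ⟨z, k, h1, h2, -, h3, h4⟩ := h S (Subset.refl S)
    exact ⟨z, k, h1, h2, h3, h4⟩
  intro P
  induction P using Finset.induction_on with
  | empty => exact fun _ => ⟨fun _ _ => 1, fun _ => 0, by simp⟩
  | insert v P hvP ih =>
    intro hPS
    obtain ⟨z, k, hsymm, hz, hz', hk, hinj⟩ := ih ((subset_insert v P).trans hPS)
    have hvS : v ∈ S := hPS (mem_insert_self v P)
    set N := H.neighborFinset v with hN
    have hNv : ∀ u, u ∈ N ↔ H.Adj v u := fun u => by simp [hN]
    set lo : V → ℤ := fun u => if u ∈ P then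
      (if y u + ∑ w ∈ H.neighborFinset u, z u w = 2 * k u then z u v else z u v - 1) else 1 with hlo
    set s := y v + ∑ u ∈ N, lo u with hs
    obtain ⟨i, hi, hik⟩ : ∃ i ∈ range (T + 1),
        (s + 1) / 2 + (i : ℤ) ∉ ({u ∈ P | χ u = χ v} : Finset V).image k := by
      by_contra! hcon
      have h1 : (range (T + 1)).image (fun i : ℕ => (s + 1) / 2 + (i : ℤ)) ⊆
          ({u ∈ P | χ u = χ v} : Finset V).image k := by
        intro a ha
        obtain ⟨i, hi, rfl⟩ := mem_image.1 ha
        exact hcon i hi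
      have h2 := card_le_card h1
      rw [card_image_of_injective _ (fun a b hab => by simpa using hab), card_range] at h2
      have h3 : #{u ∈ P | χ u = χ v} ≤ #{u ∈ S | χ u = χ v} :=
        card_le_card (filter_subset_filter _ ((subset_insert v P).trans hPS))
      have h4 := hload v hvS
      have h5 := card_image_le (s := ({u ∈ P | χ u = χ v} : Finset V)) (f := k)
      omega
    set κ := (s + 1) / 2 + (i : ℤ) with hκ
    have hdv := hdeg v hvS
    rw [← hN] at hdv
    have hi' := mem_range.1 hi
    obtain ⟨U, hUN, hUc⟩ := exists_subset_card_eq (s := N) (n := (2 * κ - s).toNat) (by omega)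
    have hUc' : (#U : ℤ) = 2 * κ - s := by omega
    set g : V → ℤ := fun u => lo u + if u ∈ U then 1 else 0 with hg
    have hgsum : y v + ∑ u ∈ N, g u = 2 * κ := by
      have : ∑ u ∈ N, (if u ∈ U then (1 : ℤ) else 0) = #U := by
        rw [sum_ite_mem, inter_eq_right.2 hUN]; simp
      rw [hg, sum_add_distrib, this]; omega
    set z' : V → V → ℤ := fun a b => if a = v ∧ b ∈ N then g b else
      if b = v ∧ a ∈ N then g a else z a b with hzdef
    have hvN : v ∉ N := by simp [hNv]
    have hz1 : ∀ b ∈ N, z' v b = g b := fun b hb => by simp [hzdef, hb]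
    have hz2 : ∀ b ∈ N, z' b v = g b := fun b hb => by
      have : b ≠ v := by rintro rfl; exact hvN hb
      simp [hzdef, hb, this]
    have hz3 : ∀ a b, a ≠ v → b ≠ v → z' a b = z a b := fun a b ha hb => by simp [hzdef, ha, hb]
    have hgP : ∀ u ∈ P, (y u + ∑ w ∈ H.neighborFinset u, z u w = 2 * k u ∧
        (g u = z u v ∨ g u = z u v + 1)) ∨ (y u + ∑ w ∈ H.neighborFinset u, z u w = 2 * k u + 1 ∧
        (g u = z u v ∨ g u = z u v - 1)) := by
      intro u hu
      by_cases h0 : y u + ∑ w ∈ H.neighborFinset u, z u w = 2 * k u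
      · left; refine ⟨h0, ?_⟩
        simp only [hg, hlo, hu, h0, if_true]; split_ifs <;> simp
      · right; refine ⟨(hk u hu).resolve_left h0, ?_⟩
        simp only [hg, hlo, hu, h0, if_true, if_false]; split_ifs <;> simp
    have hgP' : ∀ u, u ∉ P → 1 ≤ g u ∧ g u ≤ 2 := by
      intro u hu
      simp only [hg, hlo, hu, if_false]; split_ifs <;> simp
    have hzv : ∀ u, 1 ≤ z u v ∧ z u v ≤ 2 := fun u => by rw [hsymm]; exact hz' v u hvP
    have hg03 : ∀ u, 0 ≤ g u ∧ g u ≤ 3 := by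
      intro u
      by_cases hu : u ∈ P
      · have := hgP u hu; have := hzv u; omega
      · have := hgP' u hu; omega
    have hsum' : ∀ u ∈ P, ∑ w ∈ H.neighborFinset u, z' u w = ∑ w ∈ H.neighborFinset u, z u w ∨
        ∑ w ∈ H.neighborFinset u, z' u w = ∑ w ∈ H.neighborFinset u, z u w + (g u - z u v) := by
      intro u hu
      have huv : u ≠ v := by rintro rfl; exact hvP hu
      by_cases hadj : u ∈ N
      · right
        have hv : v ∈ H.neighborFinset u := by
          rw [SimpleGraph.mem_neighborFinset]; exact ((hNv u).1 hadj).symm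
        rw [← add_sum_erase _ _ hv, ← add_sum_erase _ (z u) hv, hz2 u hadj,
          sum_congr rfl (fun w hw => hz3 u w huv (ne_of_mem_erase hw))]
        ring
      · left
        refine sum_congr rfl fun w hw => hz3 u w huv ?_
        rintro rfl
        exact hadj ((hNv u).2 ((SimpleGraph.mem_neighborFinset _ _ _).1 hw).symm)
    refine ⟨z', Function.update k v κ, ?_, ?_, ?_, ?_, ?_⟩
    · intro a b
      simp only [hzdef]
      split_ifs with h1 h2 h3
      · exact absurd h2.2 (h1.1 ▸ hvN)
      · rfl
      · rfl
      · exact hsymm a b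
    · intro a b
      simp only [hzdef]
      split_ifs
      exacts [hg03 b, hg03 a, hz a b]
    · intro a b ha
      rw [mem_insert, not_or] at ha
      simp only [hzdef]
      split_ifs with h1 h2
      · exact absurd h1.1 ha.1
      · exact hgP' a ha.2
      · exact hz' a b ha.2
    · intro u hu
      rcases mem_insert.1 hu with rfl | huP
      · left
        rw [sum_congr rfl hz1, Function.update_self]; exact hgsum
      · have huv : u ≠ v := by rintro rfl; exact hvP huP
        rw [Function.update_of_ne huv]
        have := hsum' u huP; have := hgP u huP
        omega
    · have key : ∀ u ∈ P, χ u = χ v → k u ≠ κ := fun u hu hχ hku =>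
        hik (mem_image.2 ⟨u, mem_filter.2 ⟨hu, hχ⟩, hku⟩)
      have hne : ∀ u ∈ P, u ≠ v := by rintro u hu rfl; exact hvP hu
      intro a ha b hb hχ hkab
      rcases mem_insert.1 ha with rfl | haP <;> rcases mem_insert.1 hb with rfl | hbP
      · rfl
      · rw [Function.update_self, Function.update_of_ne (hne b hbP)] at hkab
        exact absurd hkab.symm (key b hbP hχ.symm)
      · rw [Function.update_self, Function.update_of_ne (hne a haP)] at hkab
        exact absurd hkab (key a haP hχ)
      · rw [Function.update_of_ne (hne a haP), Function.update_of_ne (hne b hbP)] at hkab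
        exact hinj a haP b hbP hχ hkab

/-- Edge weights in `{0, …, 4 * p}` for which the shifted weighted degrees are pairwise distinct on
each cluster inside `S`: a first layer spreads the degrees evenly modulo `p`, a second layer of
multiples of `p` separates the vertices sharing a residue. -/
theorem exists_weights_injOn_clusters {V ι : Type*} [Fintype V] [DecidableEq V] [DecidableEq ι]
    (H : SimpleGraph V) [DecidableRel H.Adj] (S : Finset V) (κ : V → ι) (f : V → ℤ)
    (p c δ T : ℕ) (hp : 0 < p) (hT : 2 * c < p * T) (hδ : 2 * (T + 1) < δ)
    (hdeg : ∀ v ∈ S, δ ≤ #(H.neighborFinset v)) (hH : ∀ u v, H.Adj u v → v ∈ S)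
    (hc : ∀ j, #{v ∈ S | κ v = j} ≤ c) :
    ∃ w : V → V → ℕ, (∀ u v, w u v = w v u) ∧ (∀ u v, w u v ≤ 4 * p) ∧
      ∀ u ∈ S, ∀ v ∈ S, κ u = κ v → f u + ∑ x ∈ H.neighborFinset u, (w u x : ℤ) =
        f v + ∑ x ∈ H.neighborFinset v, (w v x : ℤ) → u = v := by
  have : NeZero p := ⟨hp.ne'⟩
  have hbuilt : EdgeBuilt H S := EdgeBuilt.of_forall_exists_adj H S fun v hv => by
    have h := hdeg v hv
    obtain ⟨u, hu⟩ := card_pos.1 (show 0 < #(H.neighborFinset v) by omega)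
    rw [SimpleGraph.mem_neighborFinset] at hu
    exact ⟨u, hH v u hu, hu⟩
  obtain ⟨w₁, hsymm₁, hw₁, -, hload⟩ := hbuilt.exists_balanced_residues H κ p T c hT S hc ∅ f
    (empty_subset S) (Subset.refl S) (disjoint_empty_left S) (by simp)
  rw [empty_union] at hload
  set g : V → ℤ := fun v => f v + ∑ u ∈ H.neighborFinset v, w₁ v u with hg
  obtain ⟨z, k, hsymm, hz, hk, hinj⟩ := exists_step_weights H (fun v => (κ v, (g v : ZMod p)))
    (fun v => g v / p) S δ (T + 1) hdeg hδ fun v _ => by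
      simpa only [Prod.mk.injEq] using hload (κ v) (g v)
  have hnn : ∀ u v, 0 ≤ w₁ u v + p * z u v := fun u v => by
    have := (hw₁ u v).1; have := (hz u v).1; positivity
  have hcast : ∀ v, f v + ∑ x ∈ H.neighborFinset v, ((w₁ v x + p * z v x).toNat : ℤ) =
      g v + p * ∑ x ∈ H.neighborFinset v, z v x := by
    intro v
    rw [sum_congr rfl fun x _ => Int.toNat_of_nonneg (hnn v x), sum_add_distrib, ← mul_sum, hg]
    ring
  refine ⟨fun u v => (w₁ u v + p * z u v).toNat, fun u v => by simp only [hsymm₁ u v, hsymm u v],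
    fun u v => ?_, fun u hu v hv hκ heq => ?_⟩
  · have h1 := (hw₁ u v).2
    have h2 : (p : ℤ) * z u v ≤ p * 3 := mul_le_mul_of_nonneg_left (hz u v).2 (by positivity)
    rw [Int.toNat_le]; push_cast; linarith
  · rw [hcast, hcast] at heq
    have hmod : (g u : ZMod p) = g v := by
      have := congrArg (Int.cast : ℤ → ZMod p) heq
      simpa using this
    have hdiv : g u / p + ∑ x ∈ H.neighborFinset u, z u x =
        g v / p + ∑ x ∈ H.neighborFinset v, z v x := by
      have hp' : (p : ℤ) ≠ 0 := by exact_mod_cast hp.ne'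
      have := congrArg (· / (p : ℤ)) heq
      simpa only [Int.add_mul_ediv_left _ _ hp'] using this
    refine hinj u hu v hv (by rw [hκ, hmod]) ?_
    have h1 := hk u hu
    have h2 := hk v hv
    omega

theorem exists_bounded_summands {V : Type*} (N : Finset V) (A t : ℕ) (h : t ≤ A * #N) :
    ∃ g : V → ℕ, (∀ u, g u ≤ A) ∧ ∑ u ∈ N, g u = t := by
  classical
  induction N using Finset.induction_on generalizing t with
  | empty => exact ⟨fun _ => 0, by simp, by simp_all⟩
  | insert a N ha ih =>
    rw [card_insert_of_notMem ha, mul_add, mul_one] at h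
    obtain ⟨g, hg, hs⟩ := ih (t - min t A) (by omega)
    refine ⟨Function.update g a (min t A), fun u => ?_, ?_⟩
    · rcases eq_or_ne u a with rfl | hu
      · simp
      · simpa [hu] using hg u
    · rw [sum_insert ha, Function.update_self, sum_congr rfl (g := g), hs]
      · omega
      · intro u hu
        rw [Function.update_of_ne]
        rintro rfl; exact ha hu

/-- An injective ranking of the vertices refining the order of their labels. -/
theorem exists_injective_rank {V : Type*} [Fintype V] (x : V → ℕ) :
    ∃ ρ : V → ℕ, Function.Injective ρ ∧
      ∀ v, #{u | x u < x v} ≤ ρ v ∧ ρ v < #{u | x u < x v + 1} := by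
  classical
  let e := Fintype.equivFin V
  have hmono : ∀ u v, (x u < x v ∨ x u = x v ∧ e u < e v) →
      #{w | x w < x u ∨ x w = x u ∧ e w < e u} < #{w | x w < x v ∨ x w = x v ∧ e w < e v} := by
    intro u v h
    refine card_lt_card (ssubset_iff_of_subset ?_ |>.2 ⟨u, by simpa using h, by simp⟩)
    intro w hw
    simp only [mem_filter, mem_univ, true_and] at hw ⊢
    rcases h with h | h <;> rcases hw with hw | hw
    · left; omega
    · left; omega
    · left; omega
    · right; exact ⟨hw.1.trans h.1, hw.2.trans h.2⟩
  refine ⟨fun v => #{w | x w < x v ∨ x w = x v ∧ e w < e v}, fun u v huv => ?_, fun v => ⟨?_, ?_⟩⟩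
  · by_contra hne
    dsimp only at huv
    have hne' : e u ≠ e v := fun h => hne (e.injective h)
    rcases lt_trichotomy (x u) (x v) with h | h | h
    · exact (hmono u v (Or.inl h)).ne huv
    · rcases lt_or_gt_of_ne hne' with h' | h'
      · exact (hmono u v (Or.inr ⟨h, h'⟩)).ne huv
      · exact (hmono v u (Or.inr ⟨h.symm, h'⟩)).ne' huv
    · exact (hmono v u (Or.inl h)).ne' huv
  · refine card_le_card fun w hw => ?_
    simp only [mem_filter, mem_univ, true_and] at hw ⊢
    exact Or.inl hw
  · refine card_lt_card (ssubset_iff_of_subset ?_ |>.2 ⟨v, by simp, by simp⟩)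
    intro w hw
    simp only [mem_filter, mem_univ, true_and] at hw ⊢
    omega

/-- A symmetric matrix of weights in `[1, K]` with pairwise distinct neighborhood sums bounds the
irregularity strength. -/
theorem irregularityStrength_le_s1 {V : Type} (G : SimpleGraph V) [Fintype V] [DecidableRel G.Adj]
    (w : V → V → ℕ) (K : ℕ) (hsymm : ∀ u v, w u v = w v u)
    (hw : ∀ u v, G.Adj u v → 1 ≤ w u v ∧ w u v ≤ K)
    (hinj : Function.Injective fun v => ∑ u ∈ G.neighborFinset v, w v u) :
    irregularityStrength G ≤ K := by
  refine Nat.sInf_le ⟨Sym2.lift ⟨w, hsymm⟩, fun e => ?_, fun u v huv h => huv (hinj ?_)⟩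
  · induction e with
    | _ u v => exact fun he => hw u v he
  · simpa only [weightedDeg, Sym2.lift_mk] using h

/-- Assembly of an irregular weighting from a reservoir `S` split into clusters: the weights between
`S` and its complement are adjusted so that the vertices outside `S` reach their targets `b`, and
the weights inside `S` then separate the vertices of every cluster. -/
theorem irregularityStrength_le_of_reservoir {V : Type} [Fintype V] [DecidableEq V]
    (G : SimpleGraph V) [DecidableRel G.Adj] (S : Finset V) (cl : V → ℕ) (w₀ : V → V → ℕ)
    (h : ℕ → ℕ) (b : V → ℕ) (A K p c δ T : ℕ) (hw₀symm : ∀ u v, w₀ u v = w₀ v u)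
    (hw₀ : ∀ u v, 1 ≤ w₀ u v ∧ w₀ u v ≤ K) (hb : Function.Injective b)
    (hlow : ∀ v ∉ S, ∑ u ∈ G.neighborFinset v with u ∉ S, w₀ v u +
      ∑ u ∈ G.neighborFinset v with u ∈ S, h (cl u) ≤ b v)
    (hupp : ∀ v ∉ S, b v ≤ ∑ u ∈ G.neighborFinset v with u ∉ S, w₀ v u +
      ∑ u ∈ G.neighborFinset v with u ∈ S, h (cl u) + A * #{u ∈ G.neighborFinset v | u ∈ S})
    (hp : 0 < p) (hT : 2 * c < p * T) (hδ : 2 * (T + 1) < δ)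
    (hdeg : ∀ v ∈ S, δ ≤ #{u ∈ G.neighborFinset v | u ∈ S})
    (hc : ∀ j, #{v ∈ S | cl v = j} ≤ c)
    (hsep : ∀ v ∉ S, ∀ s ∈ S, b v < h (cl s) * #{u ∈ G.neighborFinset s | u ∉ S})
    (hclusters : ∀ s ∈ S, ∀ s' ∈ S, cl s < cl s' →
      (h (cl s) + A) * #{u ∈ G.neighborFinset s | u ∉ S} +
        (1 + 4 * p) * #{u ∈ G.neighborFinset s | u ∈ S} <
      h (cl s') * #{u ∈ G.neighborFinset s' | u ∉ S})
    (hh : ∀ s ∈ S, 1 ≤ h (cl s) ∧ h (cl s) + A ≤ K) (hpK : 1 + 4 * p ≤ K) :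
    irregularityStrength G ≤ K := by
  have hg : ∀ v, ∃ g : V → ℕ, (∀ u, g u ≤ A) ∧ (v ∉ S →
      ∑ u ∈ G.neighborFinset v with u ∈ S, g u = b v -
        (∑ u ∈ G.neighborFinset v with u ∉ S, w₀ v u +
          ∑ u ∈ G.neighborFinset v with u ∈ S, h (cl u))) := by
    intro v
    by_cases hv : v ∈ S
    · exact ⟨fun _ => 0, fun _ => Nat.zero_le _, fun hv' => absurd hv hv'⟩
    · obtain ⟨g, hg, hsum⟩ := exists_bounded_summands {u ∈ G.neighborFinset v | u ∈ S} A
        (b v - (∑ u ∈ G.neighborFinset v with u ∉ S, w₀ v u +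
          ∑ u ∈ G.neighborFinset v with u ∈ S, h (cl u))) (by have := hupp v hv; omega)
      exact ⟨g, hg, fun _ => hsum⟩
  choose g hgA hg using hg
  let H : SimpleGraph V :=
    { Adj := fun u v => G.Adj u v ∧ u ∈ S ∧ v ∈ S
      symm := ⟨fun u v huv => ⟨huv.1.symm, huv.2.2, huv.2.1⟩⟩
      loopless := ⟨fun u hu => G.loopless.irrefl u hu.1⟩ }
  have : DecidableRel H.Adj := fun u v => inferInstanceAs (Decidable (G.Adj u v ∧ u ∈ S ∧ v ∈ S))
  have hHN : ∀ v ∈ S, H.neighborFinset v = {u ∈ G.neighborFinset v | u ∈ S} := by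
    intro v hv
    ext u
    simp [H, hv]
  set f : V → ℕ := fun s => ∑ u ∈ G.neighborFinset s with u ∉ S, (h (cl s) + g u s) +
    #{u ∈ G.neighborFinset s | u ∈ S} with hf
  obtain ⟨w₂, hw₂symm, hw₂, hw₂inj⟩ := exists_weights_injOn_clusters H S cl (fun s => (f s : ℤ))
    p c δ T hp hT hδ (fun v hv => by rw [hHN v hv]; exact hdeg v hv) (fun u v huv => huv.2.2) hc
  let w : V → V → ℕ := fun u v =>
    if u ∈ S then (if v ∈ S then 1 + w₂ u v else h (cl u) + g v u)
    else (if v ∈ S then h (cl v) + g u v else w₀ u v)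
  have hout : ∀ v ∉ S, ∑ u ∈ G.neighborFinset v, w v u = b v := by
    intro v hv
    rw [← sum_filter_add_sum_filter_not _ (· ∈ S),
      sum_congr rfl (g := fun u => h (cl u) + g v u) fun u hu => by
        simp [w, hv, (mem_filter.mp hu).2],
      sum_congr rfl (g := fun u => w₀ v u) (s₁ := {u ∈ G.neighborFinset v | u ∉ S}) fun u hu => by
        simp [w, hv, (mem_filter.mp hu).2],
      sum_add_distrib, hg v hv]
    have := hlow v hv
    omega
  have hin : ∀ v ∈ S, ∑ u ∈ G.neighborFinset v, w v u =
      f v + ∑ u ∈ H.neighborFinset v, w₂ v u := by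
    intro v hv
    rw [← sum_filter_add_sum_filter_not _ (· ∈ S),
      sum_congr rfl (g := fun u => 1 + w₂ v u) fun u hu => by
        simp [w, hv, (mem_filter.mp hu).2],
      sum_congr rfl (g := fun u => h (cl v) + g u v) (s₁ := {u ∈ G.neighborFinset v | u ∉ S})
        fun u hu => by simp [w, hv, (mem_filter.mp hu).2],
      sum_add_distrib, hHN v hv, hf, sum_const, smul_eq_mul, mul_one]
    ring
  have hinlow : ∀ s ∈ S, h (cl s) * #{u ∈ G.neighborFinset s | u ∉ S} ≤
      ∑ u ∈ G.neighborFinset s, w s u := by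
    intro s hs
    rw [hin s hs, hf]
    simp only [sum_add_distrib, sum_const, smul_eq_mul]
    rw [mul_comm]
    omega
  have hinupp : ∀ s ∈ S, ∑ u ∈ G.neighborFinset s, w s u ≤
      (h (cl s) + A) * #{u ∈ G.neighborFinset s | u ∉ S} +
        (1 + 4 * p) * #{u ∈ G.neighborFinset s | u ∈ S} := by
    intro s hs
    rw [hin s hs, hf, hHN s hs]
    have h1 : ∑ u ∈ G.neighborFinset s with u ∉ S, (h (cl s) + g u s) ≤
        #{u ∈ G.neighborFinset s | u ∉ S} • (h (cl s) + A) :=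
      sum_le_card_nsmul _ _ _ fun u _ => Nat.add_le_add_left (hgA u s) _
    have h2 : ∑ u ∈ G.neighborFinset s with u ∈ S, w₂ s u ≤
        #{u ∈ G.neighborFinset s | u ∈ S} • (4 * p) :=
      sum_le_card_nsmul _ _ _ fun u _ => hw₂ s u
    rw [smul_eq_mul] at h1 h2
    simp only
    linarith
  refine irregularityStrength_le_s1 G w K ?_ ?_ ?_
  · intro u v
    by_cases hu : u ∈ S <;> by_cases hv : v ∈ S <;> simp [w, hu, hv, hw₂symm u v, hw₀symm u v]
  · intro u v _
    by_cases hu : u ∈ S <;> by_cases hv : v ∈ S <;> simp only [w, hu, hv, if_true, if_false]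
    · have := hw₂ u v; omega
    · have := hgA v u; have := hh u hu; omega
    · have := hgA u v; have := hh v hv; omega
    · exact hw₀ u v
  · intro u v huv
    simp only at huv
    by_cases hu : u ∈ S <;> by_cases hv : v ∈ S
    · rcases lt_trichotomy (cl u) (cl v) with hlt | heq | hlt
      · have := hinupp u hu; have := hinlow v hv; have := hclusters u hu v hv hlt; omega
      · refine hw₂inj u hu v hv heq ?_
        rw [hin u hu, hin v hv] at huv
        exact_mod_cast huv
      · have := hinupp v hv; have := hinlow u hu; have := hclusters v hv u hu hlt; omega
    · have := hout v hv; have := hinlow u hu; have := hsep v hv u hu; omega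
    · have := hout u hu; have := hinlow v hv; have := hsep u hu v hv; omega
    · rw [hout u hu, hout v hv] at huv
      exact hb huv

/-- Exponential moment bound for the number of `u ∈ N` with label below `a`, under a uniformly
random labeling. -/
theorem sum_exp_label_count_le {V : Type*} [Fintype V] [DecidableEq V] (N : Finset V)
    (Q a : ℕ) (hQ : 0 < Q) (ha : a ≤ Q) (t : ℝ) (ht : |t| ≤ 1) :
    ∑ x : V → Fin Q, Real.exp (t * ((#{u ∈ N | (x u : ℕ) < a} : ℝ) - #N * a / Q)) ≤
      (Q : ℝ) ^ Fintype.card V * Real.exp (t ^ 2 * #N) := by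
  have hQ' : (0 : ℝ) < Q := by exact_mod_cast hQ
  set y : Fin Q → ℝ := fun i => (if (i : ℕ) < a then 1 else 0) - a / Q with hy
  have haQ : (a : ℝ) / Q ≤ 1 := by rw [div_le_one hQ']; exact_mod_cast ha
  have haQ0 : (0 : ℝ) ≤ a / Q := by positivity
  have hy1 : ∀ i, |y i| ≤ 1 := by
    intro i
    simp only [hy]
    split_ifs <;> rw [abs_le] <;> constructor <;> linarith
  have hcount : #{i : Fin Q | (i : ℕ) < a} = a := by
    rw [Fin.card_filter_val_lt, min_eq_right ha]
  have hy0 : ∑ i, y i = 0 := by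
    simp only [hy, sum_sub_distrib, sum_boole, hcount, sum_const, card_univ, Fintype.card_fin,
      nsmul_eq_mul]
    field_simp
    ring
  have hfac : ∑ i, Real.exp (t * y i) ≤ Q * Real.exp (t ^ 2) := by
    calc ∑ i, Real.exp (t * y i) ≤ ∑ i, (1 + t * y i + t ^ 2) := by
          refine sum_le_sum fun i _ => ?_
          have h1 : |t * y i| ≤ 1 := by
            rw [abs_mul]; exact mul_le_one₀ ht (abs_nonneg _) (hy1 i)
          have h2 := (abs_le.mp (Real.abs_exp_sub_one_sub_id_le h1)).2
          have h3 : y i ^ 2 ≤ 1 := (sq_le_one_iff_abs_le_one _).mpr (hy1 i)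
          have h4 : (t * y i) ^ 2 ≤ t ^ 2 := by
            rw [mul_pow]; exact mul_le_of_le_one_right (sq_nonneg t) h3
          linarith
      _ = Q * (1 + t ^ 2) := by
          simp only [sum_add_distrib, ← mul_sum, hy0, sum_const, card_univ, Fintype.card_fin,
            nsmul_eq_mul]
          ring
      _ ≤ Q * Real.exp (t ^ 2) := by
          have := Real.add_one_le_exp (t ^ 2)
          gcongr; linarith
  have hsplit : ∀ x : V → Fin Q, Real.exp (t * ((#{u ∈ N | (x u : ℕ) < a} : ℝ) - #N * a / Q)) =
      ∏ u, (if u ∈ N then Real.exp (t * y (x u)) else 1) := by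
    intro x
    rw [Fintype.prod_ite_mem, ← Real.exp_sum, ← mul_sum]
    simp only [hy, sum_sub_distrib, sum_boole, sum_const, nsmul_eq_mul, mul_div_assoc]
  simp_rw [hsplit]
  rw [← Fintype.piFinset_univ, ← Finset.prod_univ_sum (fun _ => univ)
    (fun u i => if u ∈ N then Real.exp (t * y i) else (1 : ℝ))]
  calc ∏ u : V, ∑ i : Fin Q, (if u ∈ N then Real.exp (t * y i) else (1 : ℝ))
      ≤ ∏ u : V, ((Q : ℝ) * if u ∈ N then Real.exp (t ^ 2) else 1) := by
        refine prod_le_prod (fun u _ => sum_nonneg fun i _ => ?_) fun u _ => ?_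
        · split_ifs <;> positivity
        · split_ifs
          · exact hfac
          · simp
    _ = _ := by
        rw [prod_mul_distrib, Fintype.prod_ite_mem, prod_const, prod_const, card_univ,
          ← Real.exp_nat_mul, mul_comm (#N : ℝ)]

/-- If the Chernoff bound beats the number of events, some labeling with `Q` labels splits every
set of the family almost proportionally at every threshold. -/
theorem exists_balanced_labeling {V : Type*} [Fintype V] [DecidableEq V] (N : V → Finset V)
    (Q d : ℕ) (hQ : 0 < Q) (hN : ∀ v, #(N v) = d) (E : ℝ) (hE : 0 ≤ E) (hEd : E ≤ d) (hd : 0 < d)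
    (h : 2 * (Fintype.card V * (Q + 1)) * Real.exp (-(E ^ 2 / (4 * d))) < 1) :
    ∃ x : V → ℕ, (∀ v, x v < Q) ∧
      ∀ v, ∀ a ≤ Q, |(#{u ∈ N v | x u < a} : ℝ) - d * a / Q| ≤ E := by
  by_contra! hcon
  have hd' : (0 : ℝ) < d := by exact_mod_cast hd
  have hQ' : (0 : ℝ) < Q := by exact_mod_cast hQ
  set t : ℝ := E / (2 * d) with ht
  have ht0 : 0 ≤ t := by positivity
  have ht1 : t ≤ 1 := by rw [ht, div_le_one (by positivity)]; linarith
  set F : (V → Fin Q) → V → ℕ → ℝ := fun x v a =>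
    (#{u ∈ N v | (x u : ℕ) < a} : ℝ) - d * a / Q with hF
  have hone : ∀ x : V → Fin Q, Real.exp (t * E) ≤ ∑ v, ∑ a ∈ range (Q + 1),
      (Real.exp (t * F x v a) + Real.exp (-t * F x v a)) := by
    intro x
    obtain ⟨v, a, ha, hva⟩ := hcon (fun v => x v) fun v => (x v).2
    have hterm : Real.exp (t * E) ≤ Real.exp (t * F x v a) + Real.exp (-t * F x v a) := by
      rcases lt_abs.mp hva with h1 | h1
      · have : Real.exp (t * E) ≤ Real.exp (t * F x v a) :=
          Real.exp_le_exp.mpr (mul_le_mul_of_nonneg_left h1.le ht0)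
        linarith [Real.exp_pos (-t * F x v a)]
      · have : Real.exp (t * E) ≤ Real.exp (-t * F x v a) := by
          refine Real.exp_le_exp.mpr ?_
          have := mul_le_mul_of_nonneg_left h1.le ht0
          simp only [hF]; linarith
        linarith [Real.exp_pos (t * F x v a)]
    refine hterm.trans ?_
    have hnn : ∀ v a, 0 ≤ Real.exp (t * F x v a) + Real.exp (-t * F x v a) :=
      fun v a => by positivity
    refine le_trans ?_ (single_le_sum (fun v _ => sum_nonneg fun a _ => hnn v a) (mem_univ v))
    exact single_le_sum (f := fun a => Real.exp (t * F x v a) + Real.exp (-t * F x v a))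
      (fun a _ => hnn v a) (mem_range.mpr (by omega))
  have hsum := sum_le_sum fun (x : V → Fin Q) (_ : x ∈ univ) => hone x
  rw [sum_const, card_univ, Fintype.card_fun, Fintype.card_fin, nsmul_eq_mul, sum_comm] at hsum
  have hle : ∑ v : V, ∑ x : V → Fin Q, ∑ a ∈ range (Q + 1),
      (Real.exp (t * F x v a) + Real.exp (-t * F x v a)) ≤
      ∑ v : V, ∑ a ∈ range (Q + 1), 2 * ((Q : ℝ) ^ Fintype.card V * Real.exp (t ^ 2 * d)) := by
    refine sum_le_sum fun v _ => ?_
    rw [sum_comm]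
    refine sum_le_sum fun a ha => ?_
    have ha' : a ≤ Q := by rw [mem_range] at ha; omega
    rw [sum_add_distrib]
    have h1 := sum_exp_label_count_le (N v) Q a hQ ha' t (by rwa [abs_of_nonneg ht0])
    have h2 := sum_exp_label_count_le (N v) Q a hQ ha' (-t) (by rwa [abs_neg, abs_of_nonneg ht0])
    rw [hN, neg_sq] at h2
    rw [hN] at h1
    simp only [hF]
    linarith
  have hfin := hsum.trans hle
  simp only [sum_const, card_univ, card_range, nsmul_eq_mul] at hfin
  push_cast at hfin
  have hexp : Real.exp (t ^ 2 * d) = Real.exp (t * E) * Real.exp (-(E ^ 2 / (4 * d))) := by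
    rw [← Real.exp_add]
    congr 1
    rw [ht]; field_simp; ring
  rw [hexp] at hfin
  have hpos : 0 < (Q : ℝ) ^ Fintype.card V * Real.exp (t * E) := by positivity
  have := mul_lt_mul_of_pos_left h hpos
  linarith

theorem card_filter_le_lt {V : Type*} (s : Finset V) (x : V → ℕ) {a b : ℕ} (hab : a ≤ b) :
    (#{u ∈ s | a ≤ x u ∧ x u < b} : ℝ) = #{u ∈ s | x u < b} - #{u ∈ s | x u < a} := by
  classical
  rw [eq_sub_iff_add_eq, ← Nat.cast_add, ← card_union_of_disjoint, ← filter_or]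
  · congr 2
    refine filter_congr fun u _ => ?_
    omega
  · rw [disjoint_filter]
    omega

/-- A labeling that is balanced on all neighborhoods of a regular graph is balanced globally. -/
theorem SimpleGraph.IsRegularOfDegree.abs_label_count_sub_le {V : Type*} [Fintype V]
    {G : SimpleGraph V} [DecidableRel G.Adj] {d : ℕ} (hG : G.IsRegularOfDegree d) (hd : 0 < d)
    (x : V → ℕ) (a : ℕ) (t E : ℝ)
    (h : ∀ v, |(#{u ∈ G.neighborFinset v | x u < a} : ℝ) - d * t| ≤ E) :
    |(#{u | x u < a} : ℝ) - Fintype.card V * t| ≤ Fintype.card V * E / d := by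
  have hd' : (0 : ℝ) < d := by exact_mod_cast hd
  have hcount : ∑ v, (#{u ∈ G.neighborFinset v | x u < a} : ℝ) = d * #{u | x u < a} := by
    have h1 := sum_card_bipartiteAbove_eq_sum_card_bipartiteBelow (s := (univ : Finset V))
      (t := ({u | x u < a} : Finset V)) G.Adj
    have h2 : ∀ v, bipartiteAbove G.Adj ({u | x u < a} : Finset V) v =
        {u ∈ G.neighborFinset v | x u < a} := fun v => by
      ext u; simp [bipartiteAbove, and_comm]
    have h3 : ∀ u, bipartiteBelow G.Adj (univ : Finset V) u = G.neighborFinset u := fun u => by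
      ext v; simp [bipartiteBelow, G.adj_comm]
    simp only [h2, h3, G.card_neighborFinset_eq_degree, hG.degree_eq, sum_const, smul_eq_mul] at h1
    rw [mul_comm]
    exact_mod_cast h1
  rw [le_div_iff₀ hd', ← abs_of_pos hd', ← abs_mul]
  calc |((#{u | x u < a} : ℝ) - Fintype.card V * t) * d|
      = |∑ v, ((#{u ∈ G.neighborFinset v | x u < a} : ℝ) - d * t)| := by
        rw [sum_sub_distrib, hcount, sum_const, card_univ, nsmul_eq_mul]
        congr 1; ring
    _ ≤ ∑ v, |(#{u ∈ G.neighborFinset v | x u < a} : ℝ) - d * t| := abs_sum_le_sum_abs _ _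
    _ ≤ ∑ _v : V, E := sum_le_sum fun v _ => h v
    _ = Fintype.card V * E := by rw [sum_const, card_univ, nsmul_eq_mul]

/-- Weighted count of the labels `q ≤ x u < q + M * m`, grouped into `M` blocks of length `m`. -/
theorem abs_sum_block_weights_sub_le {V : Type*} (N : Finset V) (x : V → ℕ) (q m M : ℕ)
    (hm : 0 < m) (h : ℕ → ℕ) (H : ℕ) (hH : ∀ j < M, h j ≤ H) (hx : ∀ u ∈ N, x u < q + M * m)
    (t E : ℝ) (hbal : ∀ a ≤ q + M * m, |(#{u ∈ N | x u < a} : ℝ) - t * a| ≤ E) :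
    |((∑ u ∈ N with q ≤ x u, h ((x u - q) / m) : ℕ) : ℝ) - t * m * ∑ j ∈ range M, (h j : ℝ)| ≤
      2 * M * H * E := by
  have hE : 0 ≤ E := (abs_nonneg _).trans (hbal 0 (Nat.zero_le _))
  have hmaps : ∀ u ∈ ({u ∈ N | q ≤ x u} : Finset V), (x u - q) / m ∈ range M := by
    intro u hu
    rw [mem_filter] at hu
    have := hx u hu.1
    rw [mem_range, Nat.div_lt_iff_lt_mul hm]
    omega
  have hsum : ((∑ u ∈ N with q ≤ x u, h ((x u - q) / m) : ℕ) : ℝ) =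
      ∑ j ∈ range M, (#{u ∈ N | q + j * m ≤ x u ∧ x u < q + (j + 1) * m} : ℝ) * h j := by
    rw [← sum_fiberwise_of_maps_to hmaps]
    push_cast
    refine sum_congr rfl fun j _ => ?_
    rw [filter_filter, ← nsmul_eq_mul, ← sum_const]
    refine sum_congr (filter_congr fun u _ => ?_) fun u hu => ?_
    · rw [Nat.div_eq_iff hm]
      have : (j + 1) * m = j * m + m := by ring
      generalize j * m = k at *
      generalize (j + 1) * m = k' at *
      omega
    · have h1 := (mem_filter.mp hu).2
      have h2 : (x u - q) / m = j := by
        rw [Nat.div_eq_iff hm]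
        have : (j + 1) * m = j * m + m := by ring
        generalize j * m = k at *
        generalize (j + 1) * m = k' at *
        omega
      rw [h2]
  rw [hsum, mul_sum, ← sum_sub_distrib]
  refine (abs_sum_le_sum_abs _ _).trans ?_
  have hterm : ∀ j ∈ range M, |(#{u ∈ N | q + j * m ≤ x u ∧ x u < q + (j + 1) * m} : ℝ) * h j -
      t * m * h j| ≤ 2 * H * E := by
    intro j hj
    rw [mem_range] at hj
    have hj1 : (j + 1) * m ≤ M * m := Nat.mul_le_mul_right m hj
    have hj0 : j * m ≤ (j + 1) * m := Nat.mul_le_mul_right m (Nat.le_succ j)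
    have h1 := abs_le.mp (hbal (q + (j + 1) * m) (by omega))
    have h2 := abs_le.mp (hbal (q + j * m) (by omega))
    rw [card_filter_le_lt N x (by omega), ← sub_mul, abs_mul, Nat.abs_cast]
    have h3 : |(#{u ∈ N | x u < q + (j + 1) * m} : ℝ) - #{u ∈ N | x u < q + j * m} - t * m| ≤
        2 * E := by
      push_cast at h1 h2
      rw [abs_le]
      constructor <;> linarith
    have h4 : (h j : ℝ) ≤ H := by exact_mod_cast hH j hj
    calc _ ≤ 2 * E * H := by gcongr
      _ = _ := by ring
  refine (sum_le_sum hterm).trans_eq ?_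
  rw [sum_const, card_range, nsmul_eq_mul]
  ring

set_option maxHeartbeats 1000000 in
/-- An irregular weighting from a balanced labeling, with the requirements on the parameters stated
as explicit inequalities. -/
theorem irregularityStrength_le_of_balanced_labeling {V : Type} [Fintype V] [DecidableEq V]
    (G : SimpleGraph V) [DecidableRel G.Adj] (n d : ℕ) (hn : n = Fintype.card V)
    (hG : G.IsRegularOfDegree d) (hd : 0 < d) (x : V → ℕ) (M m R D h₀ η A K p c δ T : ℕ) (E : ℝ)
    (hM : 0 < M) (hm : 0 < m) (hR : 4 ≤ R) (hx : ∀ v, x v < M * m * R)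
    (hbal : ∀ v, ∀ a ≤ M * m * R,
      |(#{u ∈ G.neighborFinset v | x u < a} : ℝ) - d * a / (M * m * R : ℕ)| ≤ E)
    (hE : 0 ≤ E) (hER : E ≤ d / R) (hD : 0 < D) (hnD : n ≤ D * d) (hDn : D * d ≤ n + d)
    (hh : h₀ + M * η ≤ 2 * D) (hh₀ : 0 < h₀)
    (hA : 1 + 2 * (4 * M + 4) * (E * D) + d + n / (M * m * R) ≤ A * (d / R - E))
    (hsep : 2 * d + 2 * d * D / R + (4 * M + 4) * (E * D) + 1 + n ≤ h₀ * (d - d / R - E))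
    (hη : 4 * D * E + A * d + 2 * (1 + 4 * p) * (d / R) < η * (d / 2))
    (hp : 0 < p) (hT : 2 * c < p * T) (hδT : 2 * (T + 1) < δ) (hδ : (δ : ℝ) ≤ d / R - E)
    (hc : (n : ℝ) / (M * R) + 2 * (n * E / d) ≤ c)
    (hK : h₀ + M * η + A ≤ K) (hDK : D + 1 ≤ K) (hpK : 1 + 4 * p ≤ K) :
    irregularityStrength G ≤ K := by
  obtain ⟨ρ, hρinj, hρ⟩ := exists_injective_rank x
  have hd' : (0 : ℝ) < d := by exact_mod_cast hd
  have hM' : (0 : ℝ) < M := by exact_mod_cast hM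
  have hm' : (0 : ℝ) < m := by exact_mod_cast hm
  have hR' : (4 : ℝ) ≤ R := by exact_mod_cast hR
  have hR0 : (0 : ℝ) < R := by linarith
  have hD1 : (1 : ℝ) ≤ D := by exact_mod_cast hD
  have hnD' : (n : ℝ) ≤ D * d := by exact_mod_cast hnD
  have hDn' : (D : ℝ) * d ≤ n + d := by exact_mod_cast hDn
  obtain ⟨R', rfl⟩ : ∃ R', R = R' + 1 := ⟨R - 1, by omega⟩
  set q : ℕ := M * m * R' with hq
  set Q : ℕ := M * m * (R' + 1) with hQ
  have hqQ : q + M * m = Q := by rw [hq, hQ]; ring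
  have hQ0 : (0 : ℝ) < Q := by rw [hQ]; push_cast; push_cast at hR0; positivity
  have hQcast : (Q : ℝ) = M * m * (R' + 1 : ℕ) := by rw [hQ]; push_cast; ring
  set ε : ℝ := 1 / (R' + 1 : ℕ) with hε
  have hdR : (d : ℝ) / (R' + 1 : ℕ) = d * ε := by rw [hε]; ring
  have hqε : (q : ℝ) / Q = 1 - ε := by
    rw [hQcast, hε, hq]; push_cast at hR0 ⊢; field_simp; ring
  have hmQ : (m : ℝ) / Q = ε / M := by
    rw [hQcast, hε]; push_cast at hR0 ⊢; field_simp
  have hε0 : 0 < ε := by positivity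
  have hε4 : ε ≤ 1 / 4 := by rw [hε]; exact one_div_le_one_div_of_le (by norm_num) hR'
  have hdε : d * ε ≤ d / 4 := by linarith [mul_le_mul_of_nonneg_left hε4 hd'.le]
  rw [hdR] at hER hA hsep hη hδ
  set h : ℕ → ℕ := fun j => h₀ + j * η with hhdef
  have hhD : ∀ j < M, h j ≤ 2 * D := fun j hj => by
    have := Nat.mul_le_mul_right η hj.le
    simp only [hhdef]; omega
  set S : Finset V := {v | q ≤ x v} with hS
  have hmemS : ∀ v, v ∈ S ↔ q ≤ x v := fun v => by simp [hS]
  set cl : V → ℕ := fun v => (x v - q) / m with hcl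
  have hclM : ∀ v ∈ S, cl v < M := fun v hv => by
    have := hx v
    have := (hmemS v).mp hv
    simp only [hcl]
    rw [Nat.div_lt_iff_lt_mul hm]
    omega
  have hlocal : ∀ v, ∀ a ≤ Q, |(#{u ∈ G.neighborFinset v | x u < a} : ℝ) - d / Q * a| ≤ E :=
    fun v a ha => by rw [div_mul_eq_mul_div]; exact hbal v a ha
  have hglobal : ∀ a ≤ Q, |(#{u | x u < a} : ℝ) - n / Q * a| ≤ n * E / d := by
    intro a ha
    have := hG.abs_label_count_sub_le hd x a (a / Q) E fun v => by
      rw [← mul_div_assoc]; exact hbal v a ha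
    rw [← hn] at this
    rwa [div_mul_eq_mul_div, mul_div_assoc]
  have hoff : ∀ v, {u ∈ G.neighborFinset v | u ∉ S} = {u ∈ G.neighborFinset v | x u < q} :=
    fun v => filter_congr fun u _ => by rw [hmemS, not_le]
  have hoffcard : ∀ v, |(#{u ∈ G.neighborFinset v | u ∉ S} : ℝ) - d * (1 - ε)| ≤ E := by
    intro v
    rw [hoff, ← hqε]
    have := hbal v q (by omega)
    rwa [mul_div_assoc] at this
  have honcard : ∀ v, (#{u ∈ G.neighborFinset v | u ∈ S} : ℝ) =
      d - #{u ∈ G.neighborFinset v | u ∉ S} := by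
    intro v
    have h1 := card_filter_add_card_filter_not (s := G.neighborFinset v) (· ∈ S)
    rw [G.card_neighborFinset_eq_degree, hG.degree_eq] at h1
    rw [← h1]; push_cast; ring
  have hnEd : n * E / d ≤ E * D := by
    rw [div_le_iff₀ hd']
    calc n * E ≤ D * d * E := by gcongr
      _ = _ := by ring
  set w₀ : V → V → ℕ := fun u v => if q ≤ x u + x v then D + 1 else 1 with hw₀
  set C : ℝ := d * (1 - ε) + d * ε / M * ∑ j ∈ range M, (h j : ℝ) with hC
  have hbase : ∀ v ∉ S, |((∑ u ∈ G.neighborFinset v with u ∉ S, w₀ v u +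
      ∑ u ∈ G.neighborFinset v with u ∈ S, h (cl u) : ℕ) : ℝ) - (C + D * (d / Q * x v))| ≤
      (4 * M + 3) * (E * D) := by
    intro v hv
    rw [hmemS, not_le] at hv
    have h1 : ((∑ u ∈ G.neighborFinset v with u ∉ S, w₀ v u : ℕ) : ℝ) =
        #{u ∈ G.neighborFinset v | u ∉ S} +
          D * #{u ∈ G.neighborFinset v | q - x v ≤ x u ∧ x u < q} := by
      have : ∀ u, w₀ v u = 1 + D * if q - x v ≤ x u then 1 else 0 := by
        intro u
        simp only [hw₀]
        by_cases hu : q ≤ x v + x u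
        · rw [if_pos hu, if_pos (by omega)]; ring
        · rw [if_neg hu, if_neg (by omega)]; ring
      simp only [this, sum_add_distrib, ← mul_sum, sum_boole, hoff, filter_filter, sum_const,
        smul_eq_mul, mul_one]
      push_cast
      congr 4
      exact filter_congr fun u _ => and_comm
    have h2 := abs_le.mp (abs_sum_block_weights_sub_le (G.neighborFinset v) x q m M hm h (2 * D) hhD
      (fun u _ => by have := hx u; omega) (d / Q) E fun a ha => hlocal v a (by omega))
    have h3 : ∑ u ∈ G.neighborFinset v with u ∈ S, h (cl u) =
        ∑ u ∈ G.neighborFinset v with q ≤ x u, h ((x u - q) / m) :=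
      sum_congr (filter_congr fun u _ => hmemS u) fun u _ => rfl
    rw [Nat.cast_add, h1, h3, card_filter_le_lt _ _ (Nat.sub_le _ _)]
    have h4 := abs_le.mp (hlocal v q (by omega))
    have h5 := abs_le.mp (hlocal v (q - x v) (by omega))
    have h6 := abs_le.mp (hoffcard v)
    rw [Nat.cast_sub hv.le] at h5
    have h7 : (d : ℝ) / Q * m = d * ε / M := by rw [mul_div_assoc, ← hmQ]; ring
    rw [h7] at h2
    have hED : E ≤ E * D := le_mul_of_one_le_right hE hD1
    have h8 : |(#{u ∈ G.neighborFinset v | x u < q} : ℝ) - #{u ∈ G.neighborFinset v | x u < q - x v}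
        - d / Q * x v| ≤ 2 * E := by
      rw [abs_le]; constructor <;> linarith
    have h9 := mul_le_mul_of_nonneg_left (abs_le.mp h8).1 (zero_le_one.trans hD1)
    have h10 := mul_le_mul_of_nonneg_left (abs_le.mp h8).2 (zero_le_one.trans hD1)
    rw [Nat.cast_mul 2 D, Nat.cast_ofNat] at h2
    rw [abs_le]
    constructor <;> linarith
  have hρlow : ∀ v, n / Q * x v - E * D ≤ ρ v := by
    intro v
    have h1 := (abs_le.mp (hglobal (x v) (hx v).le)).1
    have h2 : (#{u | x u < x v} : ℝ) ≤ ρ v := by exact_mod_cast (hρ v).1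
    linarith
  have hρupp : ∀ v, (ρ v : ℝ) ≤ n / Q * x v + n / Q + E * D := by
    intro v
    have h1 := (abs_le.mp (hglobal (x v + 1) (hx v))).2
    have h2 : (ρ v : ℝ) ≤ #{u | x u < x v + 1} := by exact_mod_cast (hρ v).2.le
    push_cast at h1
    linarith
  have hρn : ∀ v, ρ v < n := fun v => (hρ v).2.trans_le (hn ▸ card_le_univ _)
  have hC0 : 0 ≤ C := by
    have : 0 ≤ 1 - ε := by linarith
    positivity
  have hCupp : C ≤ d + 2 * d * D * ε := by
    have h1 : ∑ j ∈ range M, (h j : ℝ) ≤ M * (2 * D) := by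
      have := sum_le_card_nsmul (range M) (fun j => (h j : ℝ)) (2 * D) fun j hj => by
        exact_mod_cast hhD j (mem_range.mp hj)
      simpa using this
    calc C ≤ d * (1 - ε) + d * ε / M * (M * (2 * D)) := by rw [hC]; gcongr
      _ = d + 2 * d * D * ε - d * ε := by field_simp; ring
      _ ≤ _ := by have : 0 ≤ d * ε := by positivity
                  linarith
  set B : ℕ := ⌈C + (4 * M + 4) * (E * D) + d⌉₊ with hB
  have hBlow : C + (4 * M + 4) * (E * D) + d ≤ B := Nat.le_ceil _
  have hBupp : (B : ℝ) < C + (4 * M + 4) * (E * D) + d + 1 := Nat.ceil_lt_add_one (by positivity)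
  have hDd : ∀ v, n / Q * (x v : ℝ) ≤ D * (d / Q * x v) ∧
      D * (d / Q * x v) ≤ n / Q * (x v : ℝ) + d := by
    intro v
    have hxQ : (x v : ℝ) / Q ≤ 1 := (div_le_one hQ0).mpr (by exact_mod_cast (hx v).le)
    have hxQ0 : (0 : ℝ) ≤ x v / Q := by positivity
    have e1 : (n : ℝ) / Q * x v = n * (x v / Q) := by ring
    have e2 : (D : ℝ) * (d / Q * x v) = D * d * (x v / Q) := by ring
    rw [e1, e2]
    constructor
    · gcongr
    · calc (D : ℝ) * d * (x v / Q) ≤ (n + d) * (x v / Q) := by gcongr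
        _ = n * (x v / Q) + d * (x v / Q) := by ring
        _ ≤ n * (x v / Q) + d := by gcongr; exact mul_le_of_le_one_right hd'.le hxQ
  have hκ : ∀ v, d * ε - E ≤ #{u ∈ G.neighborFinset v | u ∈ S} ∧
      (#{u ∈ G.neighborFinset v | u ∈ S} : ℝ) ≤ d * ε + E := by
    intro v
    have := abs_le.mp (hoffcard v)
    rw [honcard]
    constructor <;> linarith
  refine irregularityStrength_le_of_reservoir G S cl w₀ h (fun v => B + ρ v) A K p c δ T
    ?_ ?_ ?_ ?_ ?_ hp hT hδT ?_ ?_ ?_ ?_ ?_ hpK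
  · intro u v
    simp only [hw₀, add_comm]
  · intro u v
    simp only [hw₀]
    split_ifs <;> omega
  · exact fun u v huv => hρinj (Nat.add_left_cancel huv)
  · intro v hv
    have h1 := (abs_le.mp (hbase v hv)).2
    have h2 := hρlow v
    have h3 := (hDd v).2
    rw [← Nat.cast_le (α := ℝ), Nat.cast_add B]
    linarith
  · intro v hv
    have h1 := (abs_le.mp (hbase v hv)).1
    have h2 := hρupp v
    have h3 := (hDd v).1
    have h4 : (A : ℝ) * (d * ε - E) ≤ A * #{u ∈ G.neighborFinset v | u ∈ S} :=
      mul_le_mul_of_nonneg_left (hκ v).1 (Nat.cast_nonneg A)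
    have h5 : (n : ℝ) / (M * m * (R' + 1 : ℕ)) = n / Q := by rw [hQcast]
    rw [h5] at hA
    rw [← Nat.cast_le (α := ℝ), Nat.cast_add B, Nat.cast_add (_ + _), Nat.cast_mul A]
    linarith
  · intro v _
    have := (hκ v).1
    rw [← Nat.cast_le (α := ℝ)]
    linarith
  · intro j
    by_cases hj : j < M
    · have hsub : #{v ∈ S | cl v = j} ≤ #{v | q + j * m ≤ x v ∧ x v < q + (j + 1) * m} := by
        refine card_le_card fun v hv => ?_
        rw [mem_filter, hmemS, hcl, Nat.div_eq_iff hm] at hv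
        have : (j + 1) * m = j * m + m := by ring
        rw [mem_filter]
        refine ⟨mem_univ v, ?_⟩
        generalize j * m = k at *
        generalize (j + 1) * m = k' at *
        omega
      have hj1 : (j + 1) * m ≤ M * m := Nat.mul_le_mul_right m hj
      have hj0 : j * m ≤ (j + 1) * m := Nat.mul_le_mul_right m (Nat.le_succ j)
      have h1 := (abs_le.mp (hglobal (q + (j + 1) * m) (by omega))).2
      have h2 := (abs_le.mp (hglobal (q + j * m) (by omega))).1
      refine hsub.trans ?_
      rw [← Nat.cast_le (α := ℝ), card_filter_le_lt _ _ (by omega)]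
      have h3 : (n : ℝ) / Q * m = n / (M * (R' + 1 : ℕ)) := by
        rw [hQcast]; field_simp
      push_cast at h1 h2 h3 hc ⊢
      linarith
    · have : {v ∈ S | cl v = j} = ∅ :=
        filter_eq_empty_iff.mpr fun v hv hvj => hj (hvj.symm.trans_lt (hclM v hv))
      rw [this, card_empty]
      exact Nat.zero_le c
  · intro v _ s hs
    have h1 := (abs_le.mp (hoffcard s)).1
    have h2 : (ρ v : ℝ) < n := by exact_mod_cast hρn v
    have h3 : (h₀ : ℝ) ≤ h (cl s) := by exact_mod_cast Nat.le_add_right _ _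
    have h4 : 0 ≤ d - d * ε - E := by linarith
    have h5 : (h₀ : ℝ) * (d - d * ε - E) ≤ h (cl s) * #{u ∈ G.neighborFinset s | u ∉ S} := by
      gcongr
      linarith
    have h6 : 2 * (d : ℝ) * D / (R' + 1 : ℕ) = 2 * d * D * ε := by rw [hε]; ring
    rw [h6] at hsep
    rw [← Nat.cast_lt (α := ℝ), Nat.cast_add B, Nat.cast_mul (h _)]
    linarith
  · intro s hs s' hs' hlt
    have h1 := abs_le.mp (hoffcard s)
    have h2 := (abs_le.mp (hoffcard s')).1
    have h3 := (hκ s).2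
    have h4 : (h (cl s) : ℝ) + η ≤ h (cl s') := by
      have := Nat.mul_le_mul_right η (Nat.succ_le_of_lt hlt)
      have h5 : h (cl s) + η ≤ h (cl s') := by
        simp only [hhdef]; rw [Nat.succ_mul] at this; omega
      exact_mod_cast h5
    have h5 : d / 2 ≤ d - d * ε - E := by linarith
    have h6 : (h (cl s) : ℝ) ≤ 2 * D := by exact_mod_cast hhD _ (hclM s hs)
    have h7 : ((h (cl s) : ℝ) + η) * (d - d * ε - E) ≤
        h (cl s') * #{u ∈ G.neighborFinset s' | u ∉ S} := by
      gcongr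
      · linarith
      · linarith
    have h8 : ((h (cl s) : ℝ) + A) * #{u ∈ G.neighborFinset s | u ∉ S} ≤
        (h (cl s) + A) * (d - d * ε + E) := by gcongr; linarith
    have h9 : (1 + 4 * (p : ℝ)) * #{u ∈ G.neighborFinset s | u ∈ S} ≤
        (1 + 4 * p) * (2 * (d * ε)) := by gcongr; linarith
    have h10 : (A : ℝ) * (d - d * ε + E) ≤ A * d := by gcongr; linarith
    have h11 : (h (cl s) : ℝ) * E ≤ 2 * D * E := by gcongr
    have h12 : (η : ℝ) * (d / 2) ≤ η * (d - d * ε - E) := by gcongr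
    rw [← Nat.cast_lt (α := ℝ)]
    push_cast
    linarith
  · intro s hs
    have := Nat.mul_le_mul_right η (hclM s hs).le
    simp only [hhdef]
    omega

/-- The union bound needed for a balanced labeling with error `d / l ^ 3`. -/
theorem chernoff_union_bound_lt_one {n d l : ℕ} (hd : 0 < d) (hl : 10 ^ 11 ≤ l)
    (hn : (n : ℝ) ≤ Real.exp l) (hdl : (l : ℝ) ^ 8 ≤ 256 * d) :
    2 * (n * ((160 * l ^ 2 * (2048 * l) : ℕ) + 1)) *
      Real.exp (-(((d : ℝ) / l ^ 3) ^ 2 / (4 * d))) < 1 := by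
  have hl' : (10 : ℝ) ^ 11 ≤ l := by exact_mod_cast hl
  have hl0 : (0 : ℝ) < l := by linarith
  have hd' : (0 : ℝ) < d := by exact_mod_cast hd
  have hexp : (l : ℝ) ≤ Real.exp l := by linarith [Real.add_one_le_exp (l : ℝ)]
  have hQ : (((160 * l ^ 2 * (2048 * l) : ℕ) : ℝ) + 1) ≤ Real.exp (4 * l) := by
    have h1 : (((160 * l ^ 2 * (2048 * l) : ℕ) : ℝ) + 1) ≤ l ^ 4 := by
      push_cast
      nlinarith [pow_pos hl0 3, one_le_pow₀ (n := 3) (show (1 : ℝ) ≤ l by linarith)]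
    refine h1.trans ?_
    calc (l : ℝ) ^ 4 ≤ Real.exp l ^ 4 := by gcongr
      _ = Real.exp (4 * l) := by rw [← Real.exp_nat_mul]; norm_num
  have hE : (l : ℝ) ^ 2 / 1024 ≤ ((d : ℝ) / l ^ 3) ^ 2 / (4 * d) := by
    have : ((d : ℝ) / l ^ 3) ^ 2 / (4 * d) = d / (4 * l ^ 6) := by field_simp
    rw [this, div_le_div_iff₀ (by norm_num) (by positivity)]
    linarith
  calc 2 * (n * (((160 * l ^ 2 * (2048 * l) : ℕ) : ℝ) + 1)) *
        Real.exp (-(((d : ℝ) / l ^ 3) ^ 2 / (4 * d)))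
      ≤ Real.exp l * (Real.exp l * Real.exp (4 * l)) * Real.exp (-((l : ℝ) ^ 2 / 1024)) := by
        gcongr
        linarith
    _ = Real.exp (6 * l - (l : ℝ) ^ 2 / 1024) := by
        rw [← Real.exp_add, ← Real.exp_add, ← Real.exp_add]; congr 1; ring
    _ < 1 := by
        rw [Real.exp_lt_one_iff]
        nlinarith

set_option maxHeartbeats 2000000 in
/-- The balanced-labeling construction with concrete parameters, in terms of an integer
`l ≥ log n`. -/
theorem irregularityStrength_le_ceil_mul {V : Type} [Fintype V] (G : SimpleGraph V)
    [DecidableRel G.Adj] (n d l : ℕ) (hn : n = Fintype.card V) (hG : G.IsRegularOfDegree d)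
    (hd : 0 < d) (hl : 10 ^ 11 ≤ l) (hnl : (n : ℝ) ≤ Real.exp l) (hdl : (l : ℝ) ^ 8 ≤ 256 * d)
    (hnd : (d : ℝ) * l ^ 3 ≤ 8 * n) :
    (irregularityStrength G : ℝ) ≤ (n / d + 1) * (1 + 3 / l) := by
  classical
  have hl' : (10 : ℝ) ^ 11 ≤ l := by exact_mod_cast hl
  have hl0 : (0 : ℝ) < l := by linarith
  have hd' : (0 : ℝ) < d := by exact_mod_cast hd
  set E : ℝ := d / l ^ 3 with hE
  have hE0 : 0 < E := by positivity
  have hl3 : (1 : ℝ) ≤ l ^ 3 := one_le_pow₀ (by linarith)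
  obtain ⟨x, hx, hbal⟩ := exists_balanced_labeling (fun v => G.neighborFinset v)
    (160 * l ^ 2 * (2048 * l)) d (by positivity)
    (fun v => by rw [G.card_neighborFinset_eq_degree, hG.degree_eq]) E hE0.le
    (div_le_self hd'.le hl3) hd (by rw [← hn]; exact chernoff_union_bound_lt_one hd hl hnl hdl)
  set D : ℕ := ⌈(n : ℝ) / d⌉₊ with hD
  have hDlow : (n : ℝ) / d ≤ D := Nat.le_ceil _
  have hDupp : (D : ℝ) ≤ n / d + 1 := (Nat.ceil_lt_add_one (by positivity)).le
  have hnD : (n : ℝ) ≤ D * d := (div_le_iff₀ hd').mp hDlow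
  have hDn : (D : ℝ) * d ≤ n + d := by
    have := mul_le_mul_of_nonneg_right hDupp hd'.le
    rwa [add_mul, div_mul_cancel₀ _ hd'.ne', one_mul] at this
  -- `a`, `u`, `w` are `D / l ^ 3`, `D / l ^ 2`, `D / l`
  obtain ⟨a, ha⟩ : ∃ a : ℝ, a = D / l ^ 3 := ⟨_, rfl⟩
  obtain ⟨u, hu⟩ : ∃ u : ℝ, u = l * a := ⟨_, rfl⟩
  obtain ⟨w, hw⟩ : ∃ w : ℝ, w = l * u := ⟨_, rfl⟩
  have hDw : (D : ℝ) = l * w := by rw [hw, hu, ha]; field_simp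
  have hwD : (D : ℝ) / l = w := by rw [hDw]; field_simp
  have ha8 : 1 / 8 ≤ a := by
    rw [ha, div_le_div_iff₀ (by norm_num) (by positivity)]
    have : (d : ℝ) * l ^ 3 ≤ d * (8 * D) := by linarith
    linarith [le_of_mul_le_mul_left this hd']
  have hua : 10 ^ 11 * a ≤ u := by rw [hu]; gcongr
  have hwu : 10 ^ 11 * u ≤ w := by rw [hw]; gcongr; linarith
  have hDw' : 10 ^ 11 * w ≤ D := by rw [hDw]; gcongr; linarith
  set h₀ : ℕ := D + ⌈w⌉₊ with hh₀
  set η : ℕ := ⌈w / 256⌉₊ with hη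
  set A : ℕ := ⌈5734400 * u⌉₊ with hA
  set p : ℕ := ⌈(D : ℝ) / 5⌉₊ with hp
  have h₀low : D + w ≤ h₀ := by rw [hh₀]; push_cast; linarith [Nat.le_ceil w]
  have h₀upp : (h₀ : ℝ) ≤ D + w + 1 := by
    rw [hh₀]; push_cast; linarith [Nat.ceil_lt_add_one (show 0 ≤ w by linarith)]
  have hηlow : w / 256 ≤ η := Nat.le_ceil _
  have hηupp : (η : ℝ) ≤ w / 256 + 1 := (Nat.ceil_lt_add_one (by linarith)).le
  have hAlow : 5734400 * u ≤ A := Nat.le_ceil _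
  have hAupp : (A : ℝ) ≤ 5734400 * u + 1 := (Nat.ceil_lt_add_one (by linarith)).le
  have hplow : (D : ℝ) / 5 ≤ p := Nat.le_ceil _
  have hpupp : (p : ℝ) ≤ D / 5 + 1 := (Nat.ceil_lt_add_one (by linarith)).le
  have hp0 : (0 : ℝ) < p := by linarith
  have hpD : 1 + 4 * (p : ℝ) ≤ D := by linarith
  set c : ℕ := ⌈(n : ℝ) / (160 * (2048 * l)) + 2 * (n * E / d)⌉₊ with hc
  set T : ℕ := 2 * c / p + 1 with hT
  set δ : ℕ := ⌊(d : ℝ) / (2048 * l) - E⌋₊ with hδ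
  -- everything of order `d` is measured in terms of `E = d / l ^ 3`
  obtain ⟨e, he⟩ : ∃ e : ℝ, e = l * E := ⟨_, rfl⟩
  obtain ⟨y, hy⟩ : ∃ y : ℝ, y = l * e := ⟨_, rfl⟩
  have hdy : (d : ℝ) = l * y := by rw [hy, he, hE]; field_simp
  have hdR : (d : ℝ) / (2048 * l) = y / 2048 := by rw [hdy]; field_simp
  have heE : 10 ^ 11 * E ≤ e := by rw [he]; gcongr
  have hye : 10 ^ 11 * e ≤ y := by rw [hy]; gcongr; linarith
  have hdy' : 10 ^ 11 * y ≤ d := by rw [hdy]; gcongr; linarith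
  have hE1 : 1 ≤ E := by
    rw [hE, le_div_iff₀ (by positivity)]
    have h1 : (256 : ℝ) ≤ l ^ 5 := le_trans (by norm_num) (pow_le_pow_left₀ (by norm_num) hl' 5)
    have h2 : (256 : ℝ) * l ^ 3 ≤ l ^ 5 * l ^ 3 := by gcongr
    rw [← pow_add, show 5 + 3 = 8 from rfl] at h2
    linarith
  have hED : E * D = d * a := by rw [hE, ha]; field_simp
  have hDE : D * E = d * a := by rw [mul_comm, hED]
  have hDy : D * y = d * w := by rw [hDw, hdy]; ring
  have huy : u * y = d * a := by rw [hu, hdy]; ring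
  have hd1 : (1 : ℝ) ≤ d := by exact_mod_cast hd
  have hK : h₀ + 160 * η + A ≤ (n / d + 1) * (1 + 3 / (l : ℝ)) := by
    have : (h₀ : ℝ) + 160 * η + A ≤ D * (1 + 3 / l) := by
      have : (D : ℝ) * (1 + 3 / l) = D + 3 * w := by rw [← hwD]; ring
      rw [this]
      linarith
    refine this.trans ?_
    gcongr
  refine le_trans ?_ hK
  have hmain := irregularityStrength_le_of_balanced_labeling G n d hn hG hd x 160 (l ^ 2)
    (2048 * l) D h₀ η A (h₀ + 160 * η + A) p c δ T E (by norm_num) (by positivity) (by omega) hx hbal hE0.le ?_ ?_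
    ?_ ?_ ?_ ?_ ?_ ?_ ?_ ?_ ?_ ?_ ?_ ?_ le_rfl ?_ ?_
  · exact_mod_cast hmain
  · push_cast; rw [hdR]; linarith
  · exact_mod_cast (show (0 : ℝ) < D by linarith)
  · exact_mod_cast hnD
  · exact_mod_cast hDn
  · rw [← Nat.cast_le (α := ℝ)]; push_cast; linarith
  · exact_mod_cast (show (0 : ℝ) < h₀ by linarith)
  · push_cast
    rw [hdR, hED]
    have h1 : (n : ℝ) / (160 * l ^ 2 * (2048 * l)) ≤ d * a := by
      rw [← hED, hE, div_le_iff₀ (by positivity)]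
      have : (d : ℝ) / l ^ 3 * D * (160 * l ^ 2 * (2048 * l)) = 327680 * (D * d) := by
        field_simp; ring
      rw [this]
      linarith [mul_nonneg (Nat.cast_nonneg (α := ℝ) D) hd'.le]
    have h2 : (5734400 * u) * (y / 4096) ≤ A * (y / 2048 - E) := by
      gcongr <;> linarith
    have h3 : (5734400 * u) * (y / 4096) = 1400 * (d * a) := by rw [← huy]; ring
    have h4 : d * (1 / 8) ≤ d * a := by gcongr
    linarith
  · push_cast
    rw [hdR, hED]
    have h1 : 2 * (d : ℝ) * D / (2048 * l) = d * w / 1024 := by rw [← hwD]; field_simp; ring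
    have h2 : (h₀ : ℝ) * (y / 2048 + E) ≤ 2 * D * (y / 1024) := by
      gcongr <;> linarith
    have h3 : (D + w) * d ≤ h₀ * d := by gcongr
    have h4 : d * (3 + w / 1024 + 644 * a) ≤ d * (w - w / 512) := by
      gcongr
      linarith
    rw [h1]
    linarith
  · push_cast
    rw [hdR]
    have h1 : (1 + 4 * (p : ℝ)) * y ≤ D * y := by gcongr; linarith
    have h2 : (A : ℝ) * d ≤ (5734400 * u + 1) * d := by gcongr
    have h3 : w / 256 * (d / 2) ≤ η * (d / 2) := by gcongr
    have h4 : d * (4 * a + (5734400 * u + 1) + w / 1024) < d * (w / 512) := by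
      gcongr
      linarith
    linarith
  · exact_mod_cast hp0
  · exact Nat.lt_mul_div_succ _ (by exact_mod_cast hp0)
  · have h1 : (c : ℝ) ≤ D * (y / 327680 + 2 * E) + 1 := by
      refine (Nat.ceil_lt_add_one (by positivity)).le.trans ?_
      have h2 : (n : ℝ) / (160 * (2048 * l)) ≤ D * y / 327680 := by
        have : (n : ℝ) / (160 * (2048 * l)) ≤ D * d / (160 * (2048 * l)) := by gcongr
        refine this.trans_eq ?_
        rw [hdy]; field_simp; ring
      have h3 : n * E / d ≤ D * E := by
        rw [div_le_iff₀ hd']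
        have := mul_le_mul_of_nonneg_right hnD hE0.le
        linarith
      linarith
    obtain ⟨Z, hZ⟩ : ∃ Z : ℝ, Z = 10 * (y / 327680 + 2 * E) + 10 := ⟨_, rfl⟩
    have h2 : 2 * (c : ℝ) / p ≤ Z := by
      rw [div_le_iff₀ hp0]
      have h3 : Z * (D / 5) ≤ Z * p := by
        gcongr
        linarith
      rw [hZ] at h3 ⊢
      linarith
    have h3 : (T : ℝ) ≤ Z + 1 := by
      have h4 : ((2 * c / p : ℕ) : ℝ) ≤ 2 * c / p := by exact_mod_cast Nat.cast_div_le
      rw [hT, Nat.cast_add, Nat.cast_one]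
      linarith
    have h4 : y / 2048 - E < δ + 1 := by rw [← hdR]; exact Nat.lt_floor_add_one _
    rw [← Nat.cast_lt (α := ℝ)]
    push_cast
    linarith
  · push_cast
    exact Nat.floor_le (by rw [hdR]; linarith)
  · push_cast
    exact Nat.le_ceil _
  · rw [← Nat.cast_le (α := ℝ)]; push_cast; linarith
  · rw [← Nat.cast_le (α := ℝ)]; push_cast; linarith

theorem faudree_lehel_corollary :
    ∃ N : ℕ, ∀ (V : Type) [Fintype V] (G : SimpleGraph V) [DecidableRel G.Adj] (n d : ℕ),
      n = Fintype.card V → G.IsRegularOfDegree d → N ≤ n →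
      Real.log n ^ 8 ≤ (d : ℝ) →
      (d : ℝ) ≤ (n : ℝ) / Real.log n ^ 3 →
      (irregularityStrength G : ℝ) ≤ ((n : ℝ) / (d : ℝ)) * (1 + 8 / Real.log n) := by
  refine ⟨⌈Real.exp (10 ^ 11)⌉₊, fun V _ G _ n d hn hG hN hlow hupp => ?_⟩
  have hexp : Real.exp (10 ^ 11) ≤ n := Nat.ceil_le.mp hN
  have hn0 : (0 : ℝ) < n := (Real.exp_pos _).trans_le hexp
  set L : ℝ := Real.log n with hL
  have hL11 : 10 ^ 11 ≤ L := (Real.le_log_iff_exp_le hn0).mpr hexp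
  have hL0 : 0 < L := by linarith
  have hd' : (0 : ℝ) < d := (pow_pos hL0 8).trans_le hlow
  rw [le_div_iff₀ (pow_pos hL0 3)] at hupp
  have hLl : L ≤ ⌈L⌉₊ := Nat.le_ceil L
  have hl2 : (⌈L⌉₊ : ℝ) ≤ 2 * L := by linarith [Nat.ceil_lt_add_one hL0.le]
  have hmain := irregularityStrength_le_ceil_mul G n d ⌈L⌉₊ hn hG (by exact_mod_cast hd')
    (by exact_mod_cast hL11.trans hLl)
    (by rw [← Real.exp_log hn0]; exact Real.exp_le_exp.mpr hLl)
    (by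
      have := pow_le_pow_left₀ (Nat.cast_nonneg _) hl2 8
      rw [mul_pow] at this
      linarith)
    (by
      have := mul_le_mul_of_nonneg_left (pow_le_pow_left₀ (Nat.cast_nonneg _) hl2 3) hd'.le
      rw [mul_pow] at this
      linarith)
  refine hmain.trans ?_
  have h1 : 3 / (⌈L⌉₊ : ℝ) ≤ 3 / L := by gcongr
  have h2 : 3 / L ≤ 1 := by rw [div_le_one hL0]; linarith
  have h3 : L ≤ n / d := by
    rw [le_div_iff₀ hd']
    have : L * d ≤ L ^ 3 * d := by
      gcongr
      exact le_self_pow₀ (by linarith) (by norm_num)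
    linarith
  have h4 : 5 ≤ (n / d : ℝ) * (5 / L) := by
    calc (5 : ℝ) = L * (5 / L) := by field_simp
      _ ≤ _ := by gcongr
  calc ((n : ℝ) / d + 1) * (1 + 3 / ⌈L⌉₊) ≤ (n / d + 1) * (1 + 3 / L) := by gcongr
    _ = n / d * (1 + 3 / L) + (1 + 3 / L) := by ring
    _ ≤ n / d * (1 + 3 / L) + n / d * (5 / L) := by linarith
    _ = n / d * (1 + 8 / L) := by ring
end
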